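/- arXiv:1310.1198 — 4 statements merged into one kernel-verified Lean document; each statement's English description precedes it below -/
import Mathlib

section
/- Let G be a countably infinite discrete amenable group and let f : 𝓕_G → ℝ be a function such that f(Eg) = f(E) for every E ∈ 𝓕_G and g ∈ G, and f(E ∪ F) ≤ f(E) + f(F) whenever E, F ∈ 𝓕_G are disjoint. Then for any tiling Følner sequence {F_n : n ∈ ℕ} of G the sequence f(F_n)/|F_n| converges (in ℝ ∪ {−∞}), the value of the limit is independent of the choice of tiling Følner sequence, and lim_{n→∞} f(F_n)/|F_n| = inf_{T ∈ 𝒯_G} f(T)/|T| = inf_{n ∈ ℕ} f(F_n)/|F_n|. -/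
open Filter Topology
open scoped symmDiff Pointwise

/-- `F` is a Følner sequence of `G`: each `F n` is a non-empty finite subset and for every
`g ∈ G` we have `|gF_n Δ F_n| / |F_n| → 0`. -/
def IsFolner {G : Type*} [Group G] [DecidableEq G] (F : ℕ → Finset G) : Prop :=
  (∀ n, (F n).Nonempty) ∧
    ∀ g : G, Tendsto (fun n => ((((F n).image (g * ·)) ∆ (F n)).card : ℝ) / ((F n).card : ℝ))
      atTop (𝓝 0)

/-- A non-empty finite subset `T` tiles `G` if some family of right translates
`{T c : c ∈ C}` forms a partition of `G`. -/
def Tiles {G : Type*} [Group G] (T : Finset G) : Prop :=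
  T.Nonempty ∧ ∃ C : Set G, ∀ x : G, ∃! c : G, c ∈ C ∧ ∃ t ∈ T, x = t * c

section Subadditive

variable {G : Type*} [DecidableEq G] {f : Finset G → ℝ}

theorem subadditive_biUnion_le_sum {ι : Type*} [DecidableEq ι] (h0 : f ∅ = 0)
    (hsub : ∀ E F : Finset G, Disjoint E F → f (E ∪ F) ≤ f E + f F)
    (s : Finset ι) (A : ι → Finset G) (hA : (s : Set ι).PairwiseDisjoint A) :
    f (s.biUnion A) ≤ ∑ i ∈ s, f (A i) := by
  induction s using Finset.induction_on with
  | empty => simp [h0]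
  | insert a s ha ih =>
    rw [Finset.biUnion_insert, Finset.sum_insert ha]
    have hd : Disjoint (A a) (s.biUnion A) := by
      rw [Finset.disjoint_biUnion_right]
      intro i hi
      exact hA (by simp) (by simp [hi]) (by rintro rfl; exact ha hi)
    have := ih (hA.subset (by simp))
    linarith [hsub _ _ hd]

variable [Group G]

theorem subadditive_le_card_mul (h0 : f ∅ = 0)
    (hinv : ∀ (E : Finset G) (g : G), f (E.image (· * g)) = f E)
    (hsub : ∀ E F : Finset G, Disjoint E F → f (E ∪ F) ≤ f E + f F) (A : Finset G) :
    f A ≤ A.card * f {1} := by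
  have h := subadditive_biUnion_le_sum h0 hsub A (fun x => ({x} : Finset G))
    (fun x _ y _ hxy => by simpa using hxy)
  have h1 (x : G) : f {x} = f {1} := by simpa using hinv {1} x
  simpa [h1] using h

/-- A tile `T` packs any finite set `A` by translates, up to a remainder `R` controlled by the
boundary of `A`. -/
theorem Tiles.exists_packing {T : Finset G} (hT : Tiles T) (A : Finset G) :
    ∃ S R : Finset G, (S : Set G).PairwiseDisjoint (fun c => T.image (· * c)) ∧
      Disjoint (S.biUnion fun c => T.image (· * c)) R ∧
      (S.biUnion fun c => T.image (· * c)) ∪ R = A ∧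
      R.card ≤ ∑ p ∈ T ×ˢ T, ((A.image (p.1 * p.2⁻¹ * ·)) ∆ A).card := by
  classical
  obtain ⟨⟨t₀, ht₀⟩, C, hC⟩ := hT
  let S := (A.image (t₀⁻¹ * ·)).filter fun c => c ∈ C ∧ T.image (· * c) ⊆ A
  have hS (c : G) : c ∈ S ↔ c ∈ C ∧ T.image (· * c) ⊆ A := by
    simp only [S, Finset.mem_filter, and_iff_right_iff_imp]
    rintro ⟨-, h⟩
    exact Finset.mem_image.2 ⟨t₀ * c, h (Finset.mem_image_of_mem _ ht₀), by simp⟩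
  have hSA : (S.biUnion fun c => T.image (· * c)) ⊆ A :=
    Finset.biUnion_subset.2 fun c hc => ((hS c).1 hc).2
  refine ⟨S, A \ S.biUnion fun c => T.image (· * c), ?_, Finset.disjoint_sdiff,
    Finset.union_sdiff_of_subset hSA, ?_⟩
  · intro c hc d hd hcd
    refine Finset.disjoint_left.2 fun x hxc hxd => hcd ?_
    obtain ⟨t, ht, rfl⟩ := Finset.mem_image.1 hxc
    obtain ⟨u, hu, hux⟩ := Finset.mem_image.1 hxd
    exact (hC (t * c)).unique ⟨((hS c).1 hc).1, t, ht, rfl⟩ ⟨((hS d).1 hd).1, u, hu, hux.symm⟩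
  · refine (Finset.card_le_card ?_).trans Finset.card_biUnion_le
    intro x hx
    obtain ⟨hxA, hxS⟩ := Finset.mem_sdiff.1 hx
    obtain ⟨c, ⟨hc, t, ht, rfl⟩, -⟩ := hC x
    have hcS : c ∉ S := fun h =>
      hxS (Finset.mem_biUnion.2 ⟨c, h, Finset.mem_image_of_mem _ ht⟩)
    have hcA : ¬ T.image (· * c) ⊆ A := fun h => hcS ((hS c).2 ⟨hc, h⟩)
    obtain ⟨y, hy, hyA⟩ := Finset.not_subset.1 hcA
    obtain ⟨u, hu, rfl⟩ := Finset.mem_image.1 hy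
    refine Finset.mem_biUnion.2 ⟨(t, u), Finset.mk_mem_product ht hu,
      Finset.mem_symmDiff.2 (Or.inr ⟨hxA, fun h => hyA ?_⟩)⟩
    obtain ⟨z, hz, hzx⟩ := Finset.mem_image.1 h
    have : z = u * c := by
      simpa [mul_assoc, inv_mul_eq_iff_eq_mul] using hzx
    exact this ▸ hz

theorem Tiles.exists_average_le (h0 : f ∅ = 0)
    (hinv : ∀ (E : Finset G) (g : G), f (E.image (· * g)) = f E)
    (hsub : ∀ E F : Finset G, Disjoint E F → f (E ∪ F) ≤ f E + f F)
    {T : Finset G} (hT : Tiles T) {A : Finset G} (hA : A.Nonempty) :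
    ∃ r : ℝ, 0 ≤ r ∧
      r ≤ ∑ p ∈ T ×ˢ T, (((A.image (p.1 * p.2⁻¹ * ·)) ∆ A).card : ℝ) / A.card ∧
      f A / A.card ≤ (1 - r) * (f T / T.card) + r * f {1} := by
  obtain ⟨S, R, hSd, hSR, hA', hR⟩ := hT.exists_packing A
  have hAc : (0 : ℝ) < A.card := by exact_mod_cast hA.card_pos
  have hTc : (0 : ℝ) < T.card := by exact_mod_cast hT.1.card_pos
  refine ⟨R.card / A.card, by positivity, ?_, ?_⟩
  · rw [← Finset.sum_div]
    gcongr
    exact_mod_cast hR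
  · have hcard : (S.card * T.card + R.card : ℝ) = A.card := by
      rw [← hA', Finset.card_union_of_disjoint hSR, Finset.card_biUnion hSd]
      simp only [Finset.card_image_of_injective _ (mul_left_injective _), Finset.sum_const,
        smul_eq_mul]
      push_cast
      rfl
    have hS := subadditive_biUnion_le_sum h0 hsub S _ hSd
    simp only [hinv, Finset.sum_const, nsmul_eq_mul] at hS
    have hfA := hsub _ _ hSR
    rw [hA'] at hfA
    have hfR := subadditive_le_card_mul h0 hinv hsub R
    have hrew : (1 - (R.card : ℝ) / A.card) * (f T / T.card) + R.card / A.card * f {1}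
        = (S.card * f T + R.card * f {1}) / A.card := by
      have : (R.card : ℝ) = A.card - S.card * T.card := by linarith
      rw [this]
      field_simp
      ring
    rw [hrew]
    gcongr
    linarith

theorem tendsto_average_of_tiling_folner (h0 : f ∅ = 0)
    (hinv : ∀ (E : Finset G) (g : G), f (E.image (· * g)) = f E)
    (hsub : ∀ E F : Finset G, Disjoint E F → f (E ∪ F) ≤ f E + f F)
    {F : ℕ → Finset G} (hF : IsFolner F) (hFtile : ∀ n, Tiles (F n)) :
    Tendsto (fun n => ((f (F n) / ((F n).card : ℝ) : ℝ) : EReal)) atTop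
      (𝓝 (⨅ T ∈ {T : Finset G | Tiles T}, ((f T / (T.card : ℝ) : ℝ) : EReal))) := by
  refine tendsto_order.2 ⟨fun a ha => .of_forall fun n => ha.trans_le (iInf₂_le _ (hFtile n)),
    fun b hb => ?_⟩
  obtain ⟨T, hT, hTb⟩ : ∃ T, ∃ _ : Tiles T, ((f T / (T.card : ℝ) : ℝ) : EReal) < b := by
    simpa only [iInf_lt_iff, Set.mem_ofPred_eq] using hb
  choose r hr0 hr1 hr2 using fun n => Tiles.exists_average_le h0 hinv hsub hT (hF.1 n)
  have hr : Tendsto r atTop (𝓝 0) := by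
    refine squeeze_zero hr0 hr1 ?_
    simpa using tendsto_finsetSum (T ×ˢ T) fun p _ => hF.2 (p.1 * p.2⁻¹)
  have hlim : Tendsto (fun n => (1 - r n) * (f T / T.card) + r n * f {1}) atTop
      (𝓝 (f T / T.card)) := by
    simpa using ((hr.const_sub 1).mul_const (f T / T.card)).add (hr.mul_const (f {1}))
  filter_upwards [(continuous_coe_real_ereal.tendsto _ |>.comp hlim).eventually_lt_const hTb]
    with n hn
  exact lt_of_le_of_lt (EReal.coe_le_coe_iff.2 (hr2 n)) hn

end Subadditive

/-- Proposition 2.5 of the paper: for a right-invariant sub-additive function on the non-empty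
finite subsets of a countably infinite (discrete) amenable group, along any tiling Følner
sequence the averages `f(F_n)/|F_n|` converge (in `ℝ ∪ {-∞}`, i.e. in `EReal`) to
`inf_{T ∈ 𝒯_G} f(T)/|T|` (a quantity independent of the chosen tiling Følner sequence),
and this equals `inf_n f(F_n)/|F_n|`. -/
theorem subadditive_convergence_tiling_folner
    {G : Type*} [Group G] [Countable G] [Infinite G] [DecidableEq G]
    (f : Finset G → ℝ)
    (hinv : ∀ E : Finset G, E.Nonempty → ∀ g : G, f (E.image (· * g)) = f E)
    (hsub : ∀ E F : Finset G, E.Nonempty → F.Nonempty → Disjoint E F →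
      f (E ∪ F) ≤ f E + f F)
    (F : ℕ → Finset G) (hF : IsFolner F) (hFtile : ∀ n, Tiles (F n)) :
    Tendsto (fun n => ((f (F n) / ((F n).card : ℝ) : ℝ) : EReal)) atTop
        (𝓝 (⨅ T ∈ {T : Finset G | Tiles T}, ((f T / (T.card : ℝ) : ℝ) : EReal))) ∧
      (⨅ T ∈ {T : Finset G | Tiles T}, ((f T / (T.card : ℝ) : ℝ) : EReal))
        = ⨅ n : ℕ, ((f (F n) / ((F n).card : ℝ) : ℝ) : EReal) := by
  have key : Tendsto (fun n => ((f (F n) / ((F n).card : ℝ) : ℝ) : EReal)) atTop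
      (𝓝 (⨅ T ∈ {T : Finset G | Tiles T}, ((f T / (T.card : ℝ) : ℝ) : EReal))) := by
    have hf {T : Finset G} (hT : T.Nonempty) : Function.update f ∅ 0 T = f T :=
      Function.update_of_ne hT.ne_empty _ _
    have h := tendsto_average_of_tiling_folner (f := Function.update f ∅ 0) (by simp)
      (fun E g => ?_) (fun A B hAB => ?_) hF hFtile
    · simp only [hf (hF.1 _)] at h
      convert h using 2
      exact iInf_congr fun T => iInf_congr fun hT => by rw [hf hT.1]
    · rcases E.eq_empty_or_nonempty with rfl | hE
      · simp
      · rw [hf hE, hf (hE.image _), hinv E hE]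
    · rcases A.eq_empty_or_nonempty with rfl | hA
      · simp
      rcases B.eq_empty_or_nonempty with rfl | hB
      · simp
      rw [hf hA, hf hB, hf (hA.mono Finset.subset_union_left)]
      exact hsub A B hA hB hAB
  exact ⟨key, le_antisymm (le_iInf fun n => iInf₂_le _ (hFtile n))
    (ge_of_tendsto' key fun n => iInf_le _ n)⟩
end

section
/- Let G be a countably infinite discrete amenable group and let f : 𝓕_G → ℝ be a function such that f(Eg) = f(E) for every E ∈ 𝓕_G and g ∈ G, and f(E ∩ F) + f(E ∪ F) ≤ f(E) + f(F) for all E, F ∈ 𝓕_G (with the convention f(∅) = 0). Then for any Følner sequence {F_n : n ∈ ℕ} of G the sequence f(F_n)/|F_n| converges (in ℝ ∪ {−∞}), the value of the limit is independent of the choice of Følner sequence, and lim_{n→∞} f(F_n)/|F_n| = inf_{F ∈ 𝓕_G} f(F)/|F| = inf_{n ∈ ℕ} f(F_n)/|F_n|. -/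
open Filter Topology
open scoped symmDiff Pointwise

/-- A submodular function on finite sets that vanishes at `∅` dominates, on the subsets of `F`,
an additive function with the same value at `F`. -/
theorem exists_sum_le_of_submodular {α : Type*} [DecidableEq α] (f : Finset α → ℝ)
    (hf0 : f ∅ = 0) (hsub : ∀ E F : Finset α, f (E ∩ F) + f (E ∪ F) ≤ f E + f F)
    (F : Finset α) :
    ∃ w : α → ℝ, ∑ x ∈ F, w x = f F ∧ ∀ A ⊆ F, ∑ x ∈ A, w x ≤ f A := by
  induction F using Finset.induction_on with
  | empty =>
    refine ⟨0, by simp [hf0], fun A hA => ?_⟩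
    simp [Finset.subset_empty.1 hA, hf0]
  | insert a F ha ih =>
    obtain ⟨w, hw, hle⟩ := ih
    have hagree : ∀ B : Finset α, a ∉ B →
        ∑ x ∈ B, Function.update w a (f (insert a F) - f F) x = ∑ x ∈ B, w x := fun B hB =>
      Finset.sum_congr rfl fun x hx =>
        Function.update_of_ne (ne_of_mem_of_not_mem hx hB) _ _
    refine ⟨Function.update w a (f (insert a F) - f F), ?_, fun A hA => ?_⟩
    · rw [Finset.sum_insert ha, hagree F ha, hw, Function.update_self]
      ring
    · by_cases haA : a ∈ A
      · have hinter : A ∩ F = A.erase a := by grind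
        have hunion : A ∪ F = insert a F := by grind
        have h := hsub A F
        have hA' := hle (A.erase a) (by grind)
        rw [hinter, hunion] at h
        rw [← Finset.add_sum_erase A _ haA, hagree _ (Finset.notMem_erase a A),
          Function.update_self]
        linarith
      · rw [hagree A haA]
        exact hle A (by grind)

/-- The elements `g` of `F` such that the right translate `E g` is contained in `F`. -/
def translateCore {G : Type*} [Group G] [DecidableEq G] (E F : Finset G) : Finset G :=
  F.filter fun g => ∀ e ∈ E, e * g ∈ F

section

variable {G : Type*} [Group G] [DecidableEq G]

theorem card_translateCore_mul_le (f : Finset G → ℝ) (hf0 : f ∅ = 0)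
    (hinv : ∀ E : Finset G, E.Nonempty → ∀ g : G, f (E.image (· * g)) = f E)
    (hsub : ∀ E F : Finset G, f (E ∩ F) + f (E ∪ F) ≤ f E + f F)
    {E : Finset G} (hE : E.Nonempty) (F : Finset G) :
    ((translateCore E F).card : ℝ) * (E.card * f {1} - f E) ≤
      E.card * (F.card * f {1} - f F) := by
  obtain ⟨w, hw, hle⟩ := exists_sum_le_of_submodular f hf0 hsub F
  have hu : ∀ x ∈ F, 0 ≤ f {1} - w x := fun x hx => by
    have h := hle {x} (by simpa using hx)
    have hx1 : f {x} = f {1} := by simpa using hinv {1} (by simp) x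
    rw [Finset.sum_singleton, hx1] at h
    linarith
  have hlower : ∀ g ∈ translateCore E F,
      E.card * f {1} - f E ≤ ∑ e ∈ E, (f {1} - w (e * g)) := fun g hg => by
    have h := hle (E.image (· * g))
      (Finset.image_subset_iff.2 (Finset.mem_filter.1 hg).2)
    rw [hinv E hE, Finset.sum_image (mul_left_injective g).injOn] at h
    rw [Finset.sum_sub_distrib, Finset.sum_const, nsmul_eq_mul]
    linarith
  have hupper : ∀ e ∈ E, ∑ g ∈ translateCore E F, (f {1} - w (e * g)) ≤
      F.card * f {1} - f F := fun e he => by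
    rw [← hw, ← nsmul_eq_mul, ← Finset.sum_const, ← Finset.sum_sub_distrib,
      ← Finset.sum_image (f := fun x => f {1} - w x) (mul_right_injective e).injOn]
    exact Finset.sum_le_sum_of_subset_of_nonneg
      (Finset.image_subset_iff.2 fun g hg => (Finset.mem_filter.1 hg).2 e he)
      fun x hx _ => hu x hx
  calc ((translateCore E F).card : ℝ) * (E.card * f {1} - f E)
      ≤ ∑ g ∈ translateCore E F, ∑ e ∈ E, (f {1} - w (e * g)) := by
        rw [← nsmul_eq_mul]
        exact Finset.card_nsmul_le_sum _ _ _ hlower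
    _ = ∑ e ∈ E, ∑ g ∈ translateCore E F, (f {1} - w (e * g)) := Finset.sum_comm
    _ ≤ E.card * (F.card * f {1} - f F) := by
        rw [← nsmul_eq_mul]
        exact Finset.sum_le_card_nsmul _ _ _ hupper

theorem card_le_card_translateCore_add (E F : Finset G) :
    F.card ≤ (translateCore E F).card + ∑ e ∈ E, ((F.image (e * ·)) ∆ F).card := by
  have hcover : F ⊆ translateCore E F ∪
      E.biUnion fun e => ((F.image (e * ·)) ∆ F).image (e⁻¹ * ·) := fun g hg => by
    by_cases h : ∀ e ∈ E, e * g ∈ F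
    · exact Finset.mem_union_left _ (Finset.mem_filter.2 ⟨hg, h⟩)
    · push Not at h
      obtain ⟨e, he, heg⟩ := h
      refine Finset.mem_union_right _ (Finset.mem_biUnion.2 ⟨e, he, ?_⟩)
      refine Finset.mem_image.2 ⟨e * g, ?_, inv_mul_cancel_left e g⟩
      exact Finset.mem_symmDiff.2 (Or.inl ⟨Finset.mem_image_of_mem _ hg, heg⟩)
  refine (Finset.card_le_card hcover).trans ((Finset.card_union_le _ _).trans ?_)
  gcongr
  exact Finset.card_biUnion_le.trans (Finset.sum_le_sum fun e _ => Finset.card_image_le)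

theorem IsFolner.tendsto_card_translateCore_div {F : ℕ → Finset G} (hF : IsFolner F)
    (E : Finset G) :
    Tendsto (fun n => ((translateCore E (F n)).card : ℝ) / (F n).card) atTop (𝓝 1) := by
  have hsum := tendsto_finsetSum E fun e _ => hF.2 e
  have hlim := hsum.const_sub 1
  rw [Finset.sum_const_zero, sub_zero] at hlim
  have hpos : ∀ n, (0 : ℝ) < (F n).card := fun n => by exact_mod_cast (hF.1 n).card_pos
  refine tendsto_of_tendsto_of_tendsto_of_le_of_le hlim tendsto_const_nhds (fun n => ?_)
    fun n => ?_
  · have h : ((F n).card : ℝ) ≤ (translateCore E (F n)).card +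
        ∑ e ∈ E, ((((F n).image (e * ·)) ∆ (F n)).card : ℝ) := by
      exact_mod_cast card_le_card_translateCore_add E (F n)
    simp only
    rw [← Finset.sum_div, sub_le_iff_le_add, ← add_div, one_le_div (hpos n)]
    exact h
  · refine div_le_one_of_le₀ ?_ (hpos n).le
    exact Nat.cast_le.2 (Finset.card_le_card (Finset.filter_subset _ _))

end

/-- Proposition 2.3 of the paper: for a right-invariant strongly sub-additive function on the
finite subsets of a countably infinite (discrete) amenable group (with the convention
`f(∅) = 0`), along any Følner sequence the averages `f(F_n)/|F_n|` converge
(in `ℝ ∪ {-∞}`, i.e. in `EReal`) to `inf_{F ∈ 𝓕_G} f(F)/|F|` (a quantity independent of the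
chosen Følner sequence), and this equals `inf_n f(F_n)/|F_n|`. -/
theorem strongly_subadditive_convergence_folner
    {G : Type*} [Group G] [Countable G] [Infinite G] [DecidableEq G]
    (f : Finset G → ℝ) (hf0 : f ∅ = 0)
    (hinv : ∀ E : Finset G, E.Nonempty → ∀ g : G, f (E.image (· * g)) = f E)
    (hsub : ∀ E F : Finset G, f (E ∩ F) + f (E ∪ F) ≤ f E + f F)
    (F : ℕ → Finset G) (hF : IsFolner F) :
    Tendsto (fun n => ((f (F n) / ((F n).card : ℝ) : ℝ) : EReal)) atTop
        (𝓝 (⨅ E ∈ {E : Finset G | E.Nonempty}, ((f E / (E.card : ℝ) : ℝ) : EReal))) ∧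
      (⨅ E ∈ {E : Finset G | E.Nonempty}, ((f E / (E.card : ℝ) : ℝ) : EReal))
        = ⨅ n : ℕ, ((f (F n) / ((F n).card : ℝ) : ℝ) : EReal) := by
  have hbound : ∀ E : Finset G, E.Nonempty → ∀ n, f (F n) / (F n).card ≤
      f {1} - (translateCore E (F n)).card / (F n).card * (f {1} - f E / E.card) := by
    intro E hE n
    have hEpos : (0 : ℝ) < E.card := by exact_mod_cast hE.card_pos
    have hFpos : (0 : ℝ) < (F n).card := by exact_mod_cast (hF.1 n).card_pos
    have h := card_translateCore_mul_le f hf0 hinv hsub hE (F n)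
    have hdiv := div_nonneg (sub_nonneg.2 h) (mul_pos hEpos hFpos).le
    rw [← sub_nonneg]
    refine hdiv.trans_eq ?_
    field_simp
    ring
  have hlim : Tendsto (fun n => ((f (F n) / ((F n).card : ℝ) : ℝ) : EReal)) atTop
      (𝓝 (⨅ E ∈ {E : Finset G | E.Nonempty}, ((f E / (E.card : ℝ) : ℝ) : EReal))) := by
    refine tendsto_order.2 ⟨fun a ha => Eventually.of_forall fun n =>
      ha.trans_le (biInf_le _ (hF.1 n)), fun b hb => ?_⟩
    simp only [iInf_lt_iff] at hb
    obtain ⟨E, hE, hEb⟩ := hb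
    have hreal := ((hF.tendsto_card_translateCore_div E).mul_const
      (f {1} - f E / E.card)).const_sub (f {1})
    rw [one_mul, sub_sub_cancel] at hreal
    filter_upwards [(EReal.tendsto_coe.2 hreal).eventually_lt_const hEb] with n hn
    exact (EReal.coe_le_coe_iff.2 (hbound E hE n)).trans_lt hn
  exact ⟨hlim, le_antisymm (le_iInf fun n => biInf_le _ (hF.1 n))
    (ge_of_tendsto' hlim fun n => iInf_le _ n)⟩
end

section
/- Let (Y, 𝒟, ν, G) be an MDS, let 𝐃 = {d_F : F ∈ 𝓕_G} ⊆ L¹(Y, 𝒟, ν) be a non-negative sup-additive G-invariant family, and let {F_n : n ∈ ℕ} be a Følner sequence of G satisfying the Tempelman condition with constant M > 0. For α > 0 and N ∈ ℕ set Y_{α,N} = {y ∈ Y : max_{1 ≤ k ≤ N} d_{F_k}(y)/|F_k| > α}. Then ν(Y_{α,N}) ≤ (M/α) · inf_n (1/|F_n ∩ ⋂_{i=1}^N ⋂_{g ∈ F_i} g⁻¹F_n|) ∫_Y d_{F_n} dν (the infimum taken over those n for which this intersection is non-empty), and consequently ν(Y_{α,N}) ≤ (M/α) · liminf_{n→∞}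 (1/|F_n|) ∫_Y d_{F_n} dν ≤ (M/α) · sup_{F ∈ 𝓕_G} (1/|F|) ∫_Y d_F dν. -/
open MeasureTheory Filter Topology
open scoped symmDiff Pointwise ENNReal

/-- `F` satisfies the Tempelman condition with constant `M`:
`|⋃_{k ≤ n} F_k⁻¹ F_n| ≤ M |F_n|` for every `n`. -/
def TempelmanWith {G : Type*} [Group G] [DecidableEq G] (F : ℕ → Finset G) (M : ℝ) : Prop :=
  ∀ n : ℕ, ((((Finset.range (n + 1)).biUnion fun k => (F k)⁻¹ * F n).card : ℝ))
      ≤ M * ((F n).card : ℝ)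

section Superadditive

variable {G ι : Type*} [DecidableEq G]

/-- A superadditive function on non-empty finite sets dominates its sum over a non-empty finite
disjoint family at the union of that family. -/
theorem sum_le_biUnion_of_superadditive {f : Finset G → ℝ}
    (hsup : ∀ E F : Finset G, E.Nonempty → F.Nonempty → Disjoint E F → f E + f F ≤ f (E ∪ F))
    {B : ι → Finset G} {u : Finset ι} (hu : u.Nonempty) (hB : ∀ a ∈ u, (B a).Nonempty)
    (hd : (u : Set ι).PairwiseDisjoint B) :
    ∑ a ∈ u, f (B a) ≤ f (u.biUnion B) := by
  classical
  induction hu using Finset.Nonempty.cons_induction with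
  | singleton a => simp
  | cons a s ha hs ih =>
    have hBs : ∀ b ∈ s, (B b).Nonempty := fun b hb => hB b (Finset.mem_cons_of_mem hb)
    have hds : (s : Set ι).PairwiseDisjoint B :=
      hd.subset fun b hb => Finset.mem_coe.2 (Finset.mem_cons_of_mem hb)
    have hdis : Disjoint (B a) (s.biUnion B) := by
      rw [Finset.disjoint_biUnion_right]
      intro b hb
      exact hd (by simp) (by simp [hb]) (fun h => ha (h ▸ hb))
    have hne : (s.biUnion B).Nonempty := hs.biUnion hBs
    have h := hsup _ _ (hB a (by simp)) hne hdis
    rw [Finset.sum_cons, Finset.cons_eq_insert, Finset.biUnion_insert]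
    linarith [ih hBs hds]

/-- A non-negative superadditive function on non-empty finite sets is monotone. -/
theorem le_of_subset_of_superadditive {f : Finset G → ℝ}
    (hnonneg : ∀ E : Finset G, E.Nonempty → 0 ≤ f E)
    (hsup : ∀ E F : Finset G, E.Nonempty → F.Nonempty → Disjoint E F → f E + f F ≤ f (E ∪ F))
    {E F : Finset G} (hE : E.Nonempty) (hEF : E ⊆ F) : f E ≤ f F := by
  rcases (F \ E).eq_empty_or_nonempty with h | h
  · rw [hEF.antisymm (Finset.sdiff_eq_empty_iff_subset.1 h)]
  · have h1 := hsup E (F \ E) hE h Finset.disjoint_sdiff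
    rw [Finset.union_sdiff_of_subset hEF] at h1
    linarith [hnonneg _ h]

/-- A non-negative superadditive function on non-empty finite sets dominates, at any set, its sum
over a finite family of disjoint subsets. -/
theorem sum_le_of_superadditive {f : Finset G → ℝ}
    (hnonneg : ∀ E : Finset G, E.Nonempty → 0 ≤ f E)
    (hsup : ∀ E F : Finset G, E.Nonempty → F.Nonempty → Disjoint E F → f E + f F ≤ f (E ∪ F))
    {B : ι → Finset G} {u : Finset ι} (hB : ∀ a ∈ u, (B a).Nonempty)
    (hd : (u : Set ι).PairwiseDisjoint B) {E : Finset G} (hE : E.Nonempty)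
    (hBE : ∀ a ∈ u, B a ⊆ E) :
    ∑ a ∈ u, f (B a) ≤ f E := by
  rcases u.eq_empty_or_nonempty with rfl | hu
  · simpa using hnonneg E hE
  · exact (sum_le_biUnion_of_superadditive hsup hu hB hd).trans
      (le_of_subset_of_superadditive hnonneg hsup (hu.biUnion hB) (Finset.biUnion_subset.2 hBE))

end Superadditive

section Covering

variable {G : Type*} [Group G] [DecidableEq G]

/-- Vitali-type covering: from translates `F (k x) * x`, `x ∈ S`, of sets satisfying the Tempelman
condition one can select disjoint ones of total size at least `|S| / M`. -/
theorem TempelmanWith.exists_disjoint_translates {F : ℕ → Finset G} {M : ℝ}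
    (hTemp : TempelmanWith F M) (hne : ∀ n, (F n).Nonempty) (S : Finset G) (k : G → ℕ) :
    ∃ u ⊆ S, (u : Set G).PairwiseDisjoint (fun x => (F (k x)).image (· * x)) ∧
      (S.card : ℝ) ≤ M * ∑ x ∈ u, ((F (k x)).card : ℝ) := by
  obtain ⟨v, hvS, hvd, hv⟩ := Vitali.exists_disjoint_subfamily_covering_enlargement
    (fun x => (((F (k x)).image (· * x) : Finset G) : Set G)) (S : Set G)
    (fun x => (4 : ℝ) ^ k x) 2 one_lt_two (fun _ _ => by positivity)
    (∑ x ∈ S, (4 : ℝ) ^ k x)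
    (fun x hx => Finset.single_le_sum (f := fun x => (4 : ℝ) ^ k x)
      (fun _ _ => by positivity) hx)
    (fun x _ => Finset.coe_nonempty.2 ((hne (k x)).image _))
  have hfin : v.Finite := S.finite_toSet.subset hvS
  lift v to Finset G using hfin
  refine ⟨v, by exact_mod_cast hvS, fun a ha b hb hab => by
    simpa [Function.onFun, ← Finset.disjoint_coe] using hvd ha hb hab, ?_⟩
  have hcov : S ⊆ v.biUnion fun b =>
      ((Finset.range (k b + 1)).biUnion fun j => (F j)⁻¹ * F (k b)).image (· * b) := by
    intro a ha
    obtain ⟨b, hb, ⟨z, hza, hzb⟩, hle⟩ := hv a ha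
    have hk : k a ≤ k b := by
      by_contra! h
      have h1 : (4 : ℝ) ^ (k b + 1) ≤ 4 ^ k a := pow_le_pow_right₀ (by norm_num) h
      have h2 : (0 : ℝ) < 4 ^ k b := by positivity
      rw [pow_succ] at h1
      linarith
    simp only [Finset.coe_image, Set.mem_image, Finset.mem_coe] at hza hzb
    obtain ⟨g, hg, rfl⟩ := hza
    obtain ⟨g', hg', h⟩ := hzb
    simp only [Finset.mem_biUnion, Finset.mem_image, Finset.mem_range]
    refine ⟨b, hb, g⁻¹ * g', ⟨k a, by omega, Finset.mul_mem_mul (Finset.inv_mem_inv hg) hg'⟩, ?_⟩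
    rw [mul_assoc, h, inv_mul_cancel_left]
  calc (S.card : ℝ)
      ≤ ((v.biUnion fun b => ((Finset.range (k b + 1)).biUnion
          fun j => (F j)⁻¹ * F (k b)).image (· * b)).card : ℝ) := by
        exact_mod_cast Finset.card_le_card hcov
    _ ≤ ∑ b ∈ v, ((((Finset.range (k b + 1)).biUnion
          fun j => (F j)⁻¹ * F (k b)).card : ℕ) : ℝ) := by
        exact_mod_cast Finset.card_biUnion_le.trans
          (Finset.sum_le_sum fun b _ => Finset.card_image_le)
    _ ≤ ∑ b ∈ v, M * ((F (k b)).card : ℝ) := Finset.sum_le_sum fun b _ => hTemp (k b)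
    _ = _ := (Finset.mul_sum _ _ _).symm

/-- Pointwise maximal estimate along an orbit, for a single non-negative superadditive function. -/
theorem TempelmanWith.card_filter_le {F : ℕ → Finset G} {M : ℝ}
    (hTemp : TempelmanWith F M) (hM : 0 < M) (hne : ∀ n, (F n).Nonempty) {f : Finset G → ℝ}
    (hnonneg : ∀ E : Finset G, E.Nonempty → 0 ≤ f E)
    (hsup : ∀ E F : Finset G, E.Nonempty → F.Nonempty → Disjoint E F → f E + f F ≤ f (E ∪ F))
    {α : ℝ} (hα : 0 < α) {N : ℕ} {E S : Finset G} (hE : E.Nonempty)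
    (hSE : ∀ x ∈ S, ∀ i ∈ Finset.range N, ∀ g ∈ F i, g * x ∈ E)
    (hS : ∀ x ∈ S, ∃ i ∈ Finset.range N,
      α < f ((F i).image (· * x)) / ((F i).card : ℝ)) :
    (S.card : ℝ) ≤ M / α * f E := by
  choose! k hkN hk using hS
  obtain ⟨u, huS, hud, hcard⟩ := hTemp.exists_disjoint_translates hne S k
  have hsum : ∑ x ∈ u, f ((F (k x)).image (· * x)) ≤ f E := by
    refine sum_le_of_superadditive hnonneg hsup (fun x _ => (hne _).image _) hud hE ?_
    intro x hx
    rw [Finset.image_subset_iff]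
    exact fun g hg => hSE x (huS hx) (k x) (hkN x (huS hx)) g hg
  have hle : α * ∑ x ∈ u, ((F (k x)).card : ℝ) ≤ f E := by
    refine le_trans ?_ hsum
    rw [Finset.mul_sum]
    refine Finset.sum_le_sum fun x hx => ?_
    have hpos : (0 : ℝ) < (F (k x)).card := by exact_mod_cast (hne (k x)).card_pos
    exact ((lt_div_iff₀ hpos).1 (hk x (huS hx))).le
  refine hcard.trans ?_
  rw [div_mul_eq_mul_div, mul_div_assoc]
  refine mul_le_mul_of_nonneg_left ?_ hM.le
  rwa [le_div_iff₀ hα, mul_comm]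

/-- The part of `E` moved inside `E` by all elements of `K` misses at most the sum of the
symmetric differences `g E ∆ E`, `g ∈ K`. -/
theorem card_le_card_filter_add_sum_symmDiff (E K : Finset G) :
    E.card ≤ (E.filter fun x => ∀ g ∈ K, g * x ∈ E).card
      + ∑ g ∈ K, ((E.image (g * ·)) ∆ E).card := by
  have hsub : (E.filter fun x => ¬ ∀ g ∈ K, g * x ∈ E) ⊆
      K.biUnion fun g => ((E.image (g * ·)) ∆ E).image (g⁻¹ * ·) := by
    intro x hx
    simp only [Finset.mem_filter, not_forall] at hx
    obtain ⟨hxE, g, hg, hgx⟩ := hx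
    simp only [Finset.mem_biUnion, Finset.mem_image]
    exact ⟨g, hg, g * x, Finset.mem_symmDiff.2 (Or.inl ⟨Finset.mem_image_of_mem _ hxE, hgx⟩),
      inv_mul_cancel_left g x⟩
  have hcard := (Finset.card_le_card hsub).trans (Finset.card_biUnion_le.trans
    (Finset.sum_le_sum fun g _ => Finset.card_image_le))
  have := Finset.card_filter_add_card_filter_not (s := E) (fun x => ∀ g ∈ K, g * x ∈ E)
  omega

end Covering

section Integral

variable {G Y : Type*} [Group G] [MeasurableSpace Y] [MulAction G Y]

/-- The expected number of elements of a finite set `S` that move a point into `A` is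
`|S| ν(A)`. -/
theorem card_mul_measureReal_le_integral {ν : Measure Y} [IsFiniteMeasure ν]
    (hact : ∀ g : G, MeasurePreserving (fun y => g • y) ν ν) {A : Set Y}
    [DecidablePred (· ∈ A)]
    (hA : NullMeasurableSet A ν) (S : Finset G) {f : Y → ℝ} (hf : Integrable f ν)
    (h : ∀ᵐ y ∂ν, ((S.filter fun x => x • y ∈ A).card : ℝ) ≤ f y) :
    (S.card : ℝ) * ν.real A ≤ ∫ y, f y ∂ν := by
  have hpre : ∀ x : G, NullMeasurableSet ((fun y => x • y) ⁻¹' A) ν := fun x =>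
    hA.preimage (hact x).quasiMeasurePreserving
  have hind : ∀ x ∈ S, Integrable (((fun y => x • y) ⁻¹' A).indicator fun _ => (1 : ℝ)) ν :=
    fun x _ => (integrable_const _).indicator₀ (hpre x)
  calc (S.card : ℝ) * ν.real A
      = ∑ x ∈ S, ∫ y, ((fun y => x • y) ⁻¹' A).indicator (fun _ => (1 : ℝ)) y ∂ν := by
        rw [← nsmul_eq_mul, ← Finset.sum_const]
        refine Finset.sum_congr rfl fun x _ => ?_
        rw [integral_indicator₀ (hpre x)]
        simp [measureReal_def, (hact x).measure_preimage hA]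
    _ = ∫ y, ∑ x ∈ S, ((fun y => x • y) ⁻¹' A).indicator (fun _ => (1 : ℝ)) y ∂ν :=
        (integral_finsetSum S hind).symm
    _ ≤ ∫ y, f y ∂ν := by
        refine integral_mono_ae (integrable_finsetSum S hind) hf ?_
        filter_upwards [h] with y hy
        have hcount : ∑ x ∈ S, ((fun y => x • y) ⁻¹' A).indicator (fun _ => (1 : ℝ)) y
            = ((S.filter fun x => x • y ∈ A).card : ℝ) := by
          classical
          rw [Finset.card_filter, Nat.cast_sum]
          refine Finset.sum_congr rfl fun x _ => ?_
          by_cases hx : x • y ∈ A <;> simp [hx]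
        exact hcount.trans_le hy

end Integral

/-- Lemma 2.7 of the paper (maximal inequality): for a non-negative sup-additive `G`-invariant
family `𝐃 ⊆ L¹(ν)` and a Følner sequence satisfying the Tempelman condition with constant
`M > 0`, the measure of `Y_{α,N} = {y : max_{k < N} d_{F_k}(y)/|F_k| > α}` is bounded by
`(M/α) · (1/|F_n^*|) ∫ d_{F_n} dν` for every `n` with
`F_n^* = F_n ∩ ⋂_{i<N} ⋂_{g ∈ F_i} g⁻¹F_n ≠ ∅`, and consequently by
`(M/α) · liminf_n (1/|F_n|) ∫ d_{F_n} dν ≤ (M/α) · sup_F (1/|F|) ∫ d_F dν`. -/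
theorem maximal_inequality
    {G : Type*} [Group G] [Countable G] [Infinite G] [DecidableEq G]
    {Y : Type*} [MeasurableSpace Y] [MulAction G Y]
    (ν : Measure Y) [IsProbabilityMeasure ν]
    (hact : ∀ g : G, MeasurePreserving (fun y => g • y) ν ν)
    (d : Finset G → Y → ℝ)
    (hint : ∀ F : Finset G, F.Nonempty → Integrable (d F) ν)
    (hinv : ∀ F : Finset G, F.Nonempty → ∀ g : G,
      ∀ᵐ y ∂ν, d (F.image (· * g)) y = d F (g • y))
    (hnonneg : ∀ F : Finset G, F.Nonempty → ∀ᵐ y ∂ν, 0 ≤ d F y)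
    (hsup : ∀ E F : Finset G, E.Nonempty → F.Nonempty → Disjoint E F →
      ∀ᵐ y ∂ν, d E y + d F y ≤ d (E ∪ F) y)
    (F : ℕ → Finset G) (hF : IsFolner F)
    (M : ℝ) (hM : 0 < M) (hTemp : TempelmanWith F M)
    (α : ℝ) (hα : 0 < α) (N : ℕ) (hN : 0 < N) :
    (∀ n : ℕ,
        ((F n).filter fun x => ∀ i ∈ Finset.range N, ∀ g ∈ F i, g * x ∈ F n).Nonempty →
        (ν {y : Y | ∃ k ∈ Finset.range N, α < d (F k) y / ((F k).card : ℝ)}).toReal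
          ≤ M / α * ((((F n).filter fun x =>
                ∀ i ∈ Finset.range N, ∀ g ∈ F i, g * x ∈ F n).card : ℝ)⁻¹
              * ∫ y, d (F n) y ∂ν)) ∧
    ((ν {y : Y | ∃ k ∈ Finset.range N, α < d (F k) y / ((F k).card : ℝ)} : EReal)
        ≤ ((M / α : ℝ) : EReal)
          * liminf (fun n => ((((F n).card : ℝ)⁻¹ * ∫ y, d (F n) y ∂ν : ℝ) : EReal)) atTop) ∧
    (((M / α : ℝ) : EReal)
          * liminf (fun n => ((((F n).card : ℝ)⁻¹ * ∫ y, d (F n) y ∂ν : ℝ) : EReal)) atTop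
        ≤ ((M / α : ℝ) : EReal)
          * ⨆ E ∈ {E : Finset G | E.Nonempty},
              (((E.card : ℝ)⁻¹ * ∫ y, d E y ∂ν : ℝ) : EReal)) := by
  classical
  obtain ⟨hne, hFol⟩ := hF
  set A : Set Y := {y : Y | ∃ k ∈ Finset.range N, α < d (F k) y / ((F k).card : ℝ)} with hAdef
  have hA : NullMeasurableSet A ν := by
    have : A = ⋃ k ∈ Finset.range N, {y | α < d (F k) y / ((F k).card : ℝ)} := by
      ext y; simp [hAdef]
    rw [this]
    refine Finset.nullMeasurableSet_biUnion _ fun k _ => ?_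
    exact nullMeasurableSet_lt aemeasurable_const
      ((hint (F k) (hne k)).aestronglyMeasurable.aemeasurable.div_const _)
  have hae : ∀ᵐ y ∂ν, (∀ E : Finset G, E.Nonempty → 0 ≤ d E y) ∧
      (∀ E E' : Finset G, E.Nonempty → E'.Nonempty → Disjoint E E' →
        d E y + d E' y ≤ d (E ∪ E') y) ∧
      ∀ E : Finset G, E.Nonempty → ∀ g : G, d (E.image (· * g)) y = d E (g • y) := by
    simp only [eventually_and, ae_all_iff]
    exact ⟨hnonneg, hsup, hinv⟩
  have key : ∀ n : ℕ, (((F n).filter fun x =>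
      ∀ i ∈ Finset.range N, ∀ g ∈ F i, g * x ∈ F n).card : ℝ) * ν.real A
        ≤ M / α * ∫ y, d (F n) y ∂ν := by
    intro n
    rw [← integral_const_mul]
    refine card_mul_measureReal_le_integral hact hA _ ((hint _ (hne n)).const_mul _) ?_
    filter_upwards [hae] with y ⟨h0, h1, h2⟩
    refine hTemp.card_filter_le hM hne (f := fun E => d E y) h0 h1 hα (N := N) (hne n) ?_ ?_
    · intro x hx
      exact (Finset.mem_filter.1 (Finset.mem_filter.1 hx).1).2
    · intro x hx
      obtain ⟨k, hk, hlt⟩ := (Finset.mem_filter.1 hx).2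
      exact ⟨k, hk, by rwa [h2 _ (hne k)]⟩
  have hMα : 0 < M / α := div_pos hM hα
  have hMα' : (0 : EReal) ≤ ((M / α : ℝ) : EReal) := by exact_mod_cast hMα.le
  refine ⟨?_, ?_, ?_⟩
  · intro n hn
    have hpos : (0 : ℝ) < ((F n).filter fun x =>
      ∀ i ∈ Finset.range N, ∀ g ∈ F i, g * x ∈ F n).card := by exact_mod_cast hn.card_pos
    have h := key n
    rw [mul_left_comm, inv_mul_eq_div, le_div_iff₀ hpos, mul_comm]
    exact h
  · set K := (Finset.range N).biUnion F with hK
    set s : ℕ → ℝ := fun n =>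
      ∑ g ∈ K, ((((F n).image (g * ·)) ∆ (F n)).card : ℝ) / ((F n).card : ℝ) with hs
    have hs0 : Tendsto s atTop (𝓝 0) := by
      have h := tendsto_finsetSum K fun g _ => hFol g
      rwa [Finset.sum_const_zero] at h
    have hbound : ∀ n, (M / α)⁻¹ * ((1 - s n) * ν.real A)
        ≤ ((F n).card : ℝ)⁻¹ * ∫ y, d (F n) y ∂ν := by
      intro n
      have hpos : (0 : ℝ) < (F n).card := by exact_mod_cast (hne n).card_pos
      have hfilter : ((F n).filter fun x => ∀ i ∈ Finset.range N, ∀ g ∈ F i, g * x ∈ F n) =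
          (F n).filter fun x => ∀ g ∈ K, g * x ∈ F n := by
        refine Finset.filter_congr fun x _ => ?_
        simp only [hK, Finset.mem_biUnion]
        exact ⟨fun h g ⟨i, hi, hg⟩ => h i hi g hg, fun h i hi g hg => h g ⟨i, hi, hg⟩⟩
      have hcard : ((F n).card : ℝ) ≤ (((F n).filter fun x => ∀ g ∈ K, g * x ∈ F n).card : ℝ)
          + ∑ g ∈ K, ((((F n).image (g * ·)) ∆ (F n)).card : ℝ) := by
        exact_mod_cast card_le_card_filter_add_sum_symmDiff (F n) K
      have hsn : s n * (F n).card = ∑ g ∈ K, ((((F n).image (g * ·)) ∆ (F n)).card : ℝ) := by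
        rw [hs]
        simp only
        rw [← Finset.sum_div, div_mul_cancel₀ _ hpos.ne']
      have hkey := key n
      rw [hfilter] at hkey
      rw [inv_mul_le_iff₀ hMα, mul_left_comm, inv_mul_eq_div, le_div_iff₀ hpos]
      refine le_trans ?_ hkey
      rw [mul_right_comm]
      refine mul_le_mul_of_nonneg_right ?_ measureReal_nonneg
      linarith
    have hlim : Tendsto (fun n => (((M / α)⁻¹ * ((1 - s n) * ν.real A) : ℝ) : EReal)) atTop
        (𝓝 (((M / α)⁻¹ * ν.real A : ℝ) : EReal)) := by
      refine (continuous_coe_real_ereal.tendsto _).comp ?_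
      simpa using ((hs0.const_sub 1).mul_const (ν.real A)).const_mul (M / α)⁻¹
    have hle : (((M / α)⁻¹ * ν.real A : ℝ) : EReal) ≤
        liminf (fun n => ((((F n).card : ℝ)⁻¹ * ∫ y, d (F n) y ∂ν : ℝ) : EReal)) atTop := by
      rw [← hlim.liminf_eq]
      exact liminf_le_liminf (Eventually.of_forall fun n => EReal.coe_le_coe_iff.2 (hbound n))
    refine le_of_eq_of_le ?_ (mul_le_mul_of_nonneg_left hle hMα')
    rw [← EReal.coe_mul, mul_inv_cancel_left₀ hMα.ne', measureReal_def,
      EReal.coe_ennreal_toReal (measure_ne_top ν A)]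
  · refine mul_le_mul_of_nonneg_left ?_ hMα'
    refine liminf_le_of_frequently_le' (Frequently.of_forall fun n => ?_)
    exact le_iSup₂ (f := fun (E : Finset G) (_ : E ∈ {E : Finset G | E.Nonempty}) =>
      (((E.card : ℝ)⁻¹ * ∫ y, d E y ∂ν : ℝ) : EReal)) (F n) (hne n)
end

section
/- Let (Y, 𝒟, ν, G) be an MDS, let 𝐃 = {d_F : F ∈ 𝓕_G} ⊆ L¹(Y, 𝒟, ν) be a sub-additive G-bi-invariant family, and let {F_n : n ∈ ℕ} be a tempered Følner sequence of G each of whose terms tiles G. Then for ν-a.e. y ∈ Y, limsup_{n→∞} d_{F_n}(y)/|F_n| = inf_{T ∈ 𝒯_G} (1/|T|) E(d_T | 𝓘)(y); this function is G-invariant and measurable, and ∫_Y inf_{T ∈ 𝒯_G} (1/|T|) E(d_T | 𝓘)(y) dν(y) = ν(𝐃). -/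
open MeasureTheory Filter Topology
open scoped symmDiff Pointwise ENNReal

/-- `F` is tempered: `|⋃_{k ≤ n} F_k⁻¹ F_{n+1}| ≤ M |F_{n+1}|` for some `M > 0`. -/
def IsTempered {G : Type*} [Group G] [DecidableEq G] (F : ℕ → Finset G) : Prop :=
  ∃ M : ℝ, 0 < M ∧ ∀ n : ℕ,
    ((((Finset.range (n + 1)).biUnion fun k => (F k)⁻¹ * F (n + 1)).card : ℝ))
      ≤ M * ((F (n + 1)).card : ℝ)

/-- The σ-algebra `𝓘` of `G`-invariant sets. -/
def invSigma (G : Type*) {Y : Type*} [Group G] [MulAction G Y] [MeasurableSpace Y]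
    (ν : Measure Y) : MeasurableSpace Y :=
  MeasurableSpace.generateFrom {D : Set Y | MeasurableSet D ∧ ∀ g : G, ν ((g • D) ∆ D) = 0}

/-- The positive part of an extended real, as an extended non-negative real. -/
noncomputable def erealPosPart (x : EReal) : ℝ≥0∞ :=
  if x = ⊤ then ⊤ else ENNReal.ofReal x.toReal

/-- Integral of an `EReal`-valued function, with values in `EReal`. -/
noncomputable def erealIntegral {Y : Type*} [MeasurableSpace Y] (ν : Measure Y)
    (f : Y → EReal) : EReal :=
  ((∫⁻ y, erealPosPart (f y) ∂ν : ℝ≥0∞) : EReal)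
    - ((∫⁻ y, erealPosPart (-(f y)) ∂ν : ℝ≥0∞) : EReal)

section InvariantSigmaAlgebra

variable {G Y : Type*} [Group G] [MeasurableSpace Y] [MulAction G Y] {ν : Measure Y}

lemma preimage_smul_ae_eq_of_measure_symmDiff {D : Set Y}
    (h : ∀ g : G, ν ((g • D) ∆ D) = 0) (g : G) : (fun y => g • y) ⁻¹' D =ᵐ[ν] D := by
  rw [Set.preimage_smul]
  exact measure_symmDiff_eq_zero_iff.1 (h g⁻¹)

lemma measurableSet_invSigma_iff {D : Set Y} :
    MeasurableSet[invSigma G ν] D ↔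
      MeasurableSet D ∧ ∀ g : G, (fun y => g • y) ⁻¹' D =ᵐ[ν] D := by
  constructor
  · intro h
    induction D, h using MeasurableSpace.generateFrom_induction with
    | hC t ht _ => exact ⟨ht.1, preimage_smul_ae_eq_of_measure_symmDiff ht.2⟩
    | empty => exact ⟨MeasurableSet.empty, fun g => by simp⟩
    | compl t _ ih => exact ⟨ih.1.compl, fun g => by
        rw [Set.preimage_compl]; exact (ih.2 g).compl⟩
    | iUnion s _ ih => exact ⟨MeasurableSet.iUnion fun n => (ih n).1, fun g => by
        rw [Set.preimage_iUnion]; exact Filter.EventuallyEq.countable_iUnion fun n => (ih n).2 g⟩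
  · rintro ⟨h, hg⟩
    refine MeasurableSpace.measurableSet_generateFrom ⟨h, fun g => ?_⟩
    rw [measure_symmDiff_eq_zero_iff, ← Set.preimage_smul_inv]
    exact hg g⁻¹

variable (G ν) in
lemma invSigma_le : invSigma G ν ≤ ‹MeasurableSpace Y› := fun _ h =>
  (measurableSet_invSigma_iff.1 h).1

lemma comp_smul_ae_eq_of_measurable_invSigma {f : Y → ℝ} (hf : Measurable[invSigma G ν] f)
    (g : G) : (fun y => f (g • y)) =ᵐ[ν] f := by
  have h : ∀ q : ℚ, ∀ᵐ y ∂ν, (f (g • y) < q ↔ f y < q) := fun q => by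
    have := (measurableSet_invSigma_iff.1 (hf (measurableSet_Iio (a := (q : ℝ))))).2 g
    filter_upwards [this] with y hy
    exact Iff.of_eq hy
  filter_upwards [ae_all_iff.2 h] with y hy
  refine le_antisymm (le_of_not_gt fun h => ?_) (le_of_not_gt fun h => ?_)
  · obtain ⟨q, h1, h2⟩ := exists_rat_btwn h
    exact ((hy q).2 h1).not_gt h2
  · obtain ⟨q, h1, h2⟩ := exists_rat_btwn h
    exact ((hy q).1 h1).not_gt h2

lemma measurable_invSigma_of_comp_smul_ae_eq {f : Y → ℝ} (hf : Measurable f)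
    (h : ∀ g : G, (fun y => f (g • y)) =ᵐ[ν] f) : Measurable[invSigma G ν] f := by
  intro s hs
  refine measurableSet_invSigma_iff.2 ⟨hf hs, fun g => ?_⟩
  filter_upwards [h g] with y hy
  change (f (g • y) ∈ s) = (f y ∈ s)
  rw [hy]

lemma condExp_invSigma_smul_ae_eq (f : Y → ℝ) (g : G) :
    (fun y => (ν[f | invSigma G ν]) (g • y)) =ᵐ[ν] ν[f | invSigma G ν] :=
  comp_smul_ae_eq_of_measurable_invSigma stronglyMeasurable_condExp.measurable g

lemma condExp_invSigma_comp_smul [MeasurableConstSMul G Y] [SMulInvariantMeasure G Y ν]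
    [IsFiniteMeasure ν] {f : Y → ℝ} (hf : Integrable f ν) (g : G) :
    ν[fun y => f (g • y) | invSigma G ν] =ᵐ[ν] ν[f | invSigma G ν] := by
  have hg := measurePreserving_smul g ν
  refine (ae_eq_condExp_of_forall_setIntegral_eq (invSigma_le G ν)
    ((hg.integrable_comp_of_integrable hf)) (fun _ _ _ => integrable_condExp.integrableOn) ?_
    stronglyMeasurable_condExp.aestronglyMeasurable).symm
  intro s hs _
  rw [setIntegral_condExp (invSigma_le G ν) hf hs,
    ← hg.setIntegral_preimage_emb (measurableEmbedding_const_smul g)]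
  exact setIntegral_congr_set ((measurableSet_invSigma_iff.1 hs).2 g)

end InvariantSigmaAlgebra

section MaximalInequality

variable {G Y : Type*} [Group G] [DecidableEq G] [MulAction G Y]

/-- Weights of a greedy fractional packing of orbits by translates of the sets `H k`, where
translates of `H k` are placed at the points of `E k`. -/
noncomputable def packingWeight (H : ℕ → Finset G) (E : ℕ → Set Y) (k : ℕ) : Y → ℝ≥0∞ :=
  (E k).indicator fun y =>
    1 - ∑ i : Fin k, ∑ h ∈ (H i)⁻¹ * H k, packingWeight H E i (h • y) / (H i).card
termination_by k
decreasing_by exact i.2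

lemma packingWeight_eq (H : ℕ → Finset G) (E : ℕ → Set Y) (k : ℕ) :
    packingWeight H E k = (E k).indicator fun y =>
      1 - ∑ i ∈ Finset.range k, ∑ h ∈ (H i)⁻¹ * H k, packingWeight H E i (h • y) / (H i).card := by
  rw [packingWeight]
  congr 1
  ext y
  rw [Finset.sum_range fun i => ∑ h ∈ (H i)⁻¹ * H k, packingWeight H E i (h • y) / (H i).card]

lemma packingWeight_multiplicity_le_one {H : ℕ → Finset G} (E : ℕ → Set Y) (k : ℕ) (y : Y) :
    ∑ i ∈ Finset.range k, ∑ g ∈ H i, packingWeight H E i (g⁻¹ • y) / (H i).card ≤ 1 := by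
  induction k with
  | zero => simp
  | succ k ih =>
    rw [Finset.sum_range_succ]
    set s := ∑ i ∈ Finset.range k, ∑ g ∈ H i, packingWeight H E i (g⁻¹ • y) / (H i).card with hs
    have key : ∀ g ∈ H k, packingWeight H E k (g⁻¹ • y) ≤ 1 - s := by
      intro g hg
      rw [packingWeight_eq]
      refine (Set.indicator_le_self' (fun _ _ => zero_le) _).trans (tsub_le_tsub_left ?_ 1)
      rw [hs]
      refine Finset.sum_le_sum fun i _ => ?_
      have : ∑ x ∈ H i, packingWeight H E i (x⁻¹ • y) / (H i).card
          = ∑ h ∈ (H i).image (fun x => x⁻¹ * g),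
              packingWeight H E i (h • g⁻¹ • y) / (H i).card := by
        rw [Finset.sum_image fun a _ b _ hab => by simpa using hab]
        simp [smul_smul]
      rw [this]
      refine Finset.sum_le_sum_of_subset fun x hx => ?_
      obtain ⟨z, hz, rfl⟩ := Finset.mem_image.1 hx
      exact Finset.mul_mem_mul (Finset.inv_mem_inv hz) hg
    have : ∑ g ∈ H k, packingWeight H E k (g⁻¹ • y) / (H k).card ≤ 1 - s := by
      refine (Finset.sum_le_sum fun g hg =>
        ENNReal.div_le_div_right (key g hg) _).trans ?_
      rw [Finset.sum_const, nsmul_eq_mul]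
      exact ENNReal.mul_div_le
    exact (add_le_add_right this s).trans_eq (add_tsub_cancel_of_le ih)

variable [MeasurableSpace Y] [MeasurableConstSMul G Y]

lemma measurable_packingWeight (H : ℕ → Finset G) {E : ℕ → Set Y}
    (hE : ∀ k, MeasurableSet (E k)) (k : ℕ) : Measurable (packingWeight H E k) := by
  induction k using Nat.strong_induction_on with
  | _ k ih =>
    rw [packingWeight_eq]
    refine Measurable.indicator ?_ (hE k)
    refine measurable_const.sub (Finset.measurable_fun_sum _ fun i hi =>
      Finset.measurable_fun_sum _ fun h _ => ?_)
    exact ((ih i (Finset.mem_range.1 hi)).comp (measurable_const_smul h)).div_const _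

variable {ν : Measure Y} [SMulInvariantMeasure G Y ν]

lemma sum_measure_le_packingWeight {H : ℕ → Finset G} {E : ℕ → Set Y}
    (hH : ∀ k, (H k).Nonempty) (hE : ∀ k, MeasurableSet (E k))
    (hdisj : Pairwise (Function.onFun Disjoint E)) {M : ℝ≥0∞} {N : ℕ}
    (htemp : ∀ i < N, ((((Finset.Ioo i N).biUnion fun j => (H j)⁻¹ * H i).card : ℕ) : ℝ≥0∞)
      ≤ M * (H i).card) :
    ∑ k ∈ Finset.range N, ν (E k)
      ≤ (1 + M) * ∑ k ∈ Finset.range N, ∫⁻ y, packingWeight H E k y ∂ν := by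
  set v := packingWeight H E with hv
  have hvm := measurable_packingWeight H hE
  have step : ∀ k, ν (E k) ≤ (∫⁻ y, v k y ∂ν) +
      ∑ i ∈ Finset.range k, ∑ h ∈ (H i)⁻¹ * H k,
        ∫⁻ y, v i y * (E k).indicator 1 (h⁻¹ • y) / (H i).card ∂ν := by
    intro k
    have hm : ∀ i, ∀ h : G, Measurable fun y => v i (h • y) * (E k).indicator 1 y / (H i).card :=
      fun i h => (((hvm i).comp (measurable_const_smul h)).mul
        (measurable_one.indicator (hE k))).div_const _
    have h1 : ∀ i, ∀ h : G, ∫⁻ y, v i y * (E k).indicator 1 (h⁻¹ • y) / (H i).card ∂ν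
        = ∫⁻ y, v i (h • y) * (E k).indicator 1 y / (H i).card ∂ν := by
      intro i h
      rw [← (measurePreserving_smul h⁻¹ ν).lintegral_comp (hm i h)]
      simp
    simp_rw [h1]
    rw [← lintegral_indicator_one (hE k)]
    simp_rw [← lintegral_finsetSum _ (fun h _ => hm _ h)]
    rw [← lintegral_finsetSum _ (fun i _ => Finset.measurable_fun_sum _ fun h _ => hm i h),
      ← lintegral_add_left (hvm k)]
    refine lintegral_mono fun y => ?_
    by_cases hy : y ∈ E k
    · simp only [hv]
      rw [packingWeight_eq]
      simp only [Set.indicator_of_mem hy, Pi.one_apply, mul_one]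
      exact le_tsub_add
    · simp [hy]
  have inner : ∀ i < N, ∑ k ∈ Finset.Ioo i N, ∑ h ∈ (H i)⁻¹ * H k,
      ∫⁻ y, v i y * (E k).indicator 1 (h⁻¹ • y) / (H i).card ∂ν ≤ M * ∫⁻ y, v i y ∂ν := by
    intro i hi
    have hm : ∀ k, ∀ h : G, Measurable fun y =>
        v i y * (E k).indicator 1 (h⁻¹ • y) / (H i).card :=
      fun k h => ((hvm i).mul ((measurable_one.indicator (hE k)).comp
        (measurable_const_smul h⁻¹))).div_const _
    simp_rw [← lintegral_finsetSum _ (fun h _ => hm _ h)]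
    rw [← lintegral_finsetSum _ (fun i _ => Finset.measurable_fun_sum _ fun h _ => hm i h),
      ← lintegral_const_mul _ (hvm i)]
    refine lintegral_mono fun y => ?_
    have hc0 : ((H i).card : ℝ≥0∞) ≠ 0 := by simpa using (hH i).ne_empty
    have hct : ((H i).card : ℝ≥0∞) ≠ ⊤ := ENNReal.natCast_ne_top _
    have count : ∑ k ∈ Finset.Ioo i N, ∑ h ∈ (H i)⁻¹ * H k,
        (E k).indicator (1 : Y → ℝ≥0∞) (h⁻¹ • y) ≤ M * (H i).card := by
      refine le_trans ?_ (htemp i hi)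
      set U := (Finset.Ioo i N).biUnion fun j => (H j)⁻¹ * H i with hU
      have e1 : ∀ k ∈ Finset.Ioo i N, ∑ h ∈ (H i)⁻¹ * H k,
          (E k).indicator (1 : Y → ℝ≥0∞) (h⁻¹ • y)
          ≤ ∑ g ∈ U, (E k).indicator (1 : Y → ℝ≥0∞) (g • y) := by
        intro k hk
        have : ∑ h ∈ (H i)⁻¹ * H k, (E k).indicator (1 : Y → ℝ≥0∞) (h⁻¹ • y)
            = ∑ g ∈ (H k)⁻¹ * H i, (E k).indicator (1 : Y → ℝ≥0∞) (g • y) := by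
          refine Finset.sum_bij' (fun a _ => a⁻¹) (fun a _ => a⁻¹) ?_ ?_ ?_ ?_ ?_
          · intro a ha
            have := Finset.inv_mem_inv ha
            rwa [mul_inv_rev, inv_inv] at this
          · intro a ha
            have := Finset.inv_mem_inv ha
            rwa [mul_inv_rev, inv_inv] at this
          all_goals simp
        rw [this]
        exact Finset.sum_le_sum_of_subset
          (Finset.subset_biUnion_of_mem (fun j => (H j)⁻¹ * H i) hk)
      refine (Finset.sum_le_sum e1).trans ?_
      rw [Finset.sum_comm, Finset.card_eq_sum_ones, Nat.cast_sum]
      refine Finset.sum_le_sum fun g _ => ?_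
      rw [Nat.cast_one]
      by_cases hg : ∃ k ∈ Finset.Ioo i N, g • y ∈ E k
      · obtain ⟨k, hk, hgk⟩ := hg
        rw [Finset.sum_eq_single_of_mem k hk]
        · simp [hgk]
        · intro l _ hlk
          exact Set.indicator_of_notMem (fun h => (hdisj hlk).le_bot ⟨h, hgk⟩) _
      · push Not at hg
        rw [Finset.sum_eq_zero fun k hk => Set.indicator_of_notMem (hg k hk) _]
        exact zero_le
    calc ∑ k ∈ Finset.Ioo i N, ∑ h ∈ (H i)⁻¹ * H k,
            v i y * (E k).indicator 1 (h⁻¹ • y) / (H i).card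
        = v i y * (∑ k ∈ Finset.Ioo i N, ∑ h ∈ (H i)⁻¹ * H k,
            (E k).indicator 1 (h⁻¹ • y)) / (H i).card := by
          simp_rw [Finset.mul_sum, div_eq_mul_inv, Finset.sum_mul]
      _ ≤ v i y * (M * (H i).card) / (H i).card := by gcongr
      _ = M * v i y := by
          rw [← mul_assoc, mul_div_assoc, ENNReal.div_self hc0 hct, mul_one, mul_comm]
  calc ∑ k ∈ Finset.range N, ν (E k)
      ≤ ∑ k ∈ Finset.range N, ((∫⁻ y, v k y ∂ν) +
        ∑ i ∈ Finset.range k, ∑ h ∈ (H i)⁻¹ * H k,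
          ∫⁻ y, v i y * (E k).indicator 1 (h⁻¹ • y) / (H i).card ∂ν) :=
        Finset.sum_le_sum fun k _ => step k
    _ = ∑ k ∈ Finset.range N, (∫⁻ y, v k y ∂ν) +
        ∑ i ∈ Finset.range N, ∑ k ∈ Finset.Ioo i N, ∑ h ∈ (H i)⁻¹ * H k,
          ∫⁻ y, v i y * (E k).indicator 1 (h⁻¹ • y) / (H i).card ∂ν := by
        rw [Finset.sum_add_distrib]
        congr 1
        refine Finset.sum_comm' fun k i => ?_
        simp only [Finset.mem_range, Finset.mem_Ioo]
        omega
    _ ≤ ∑ k ∈ Finset.range N, (∫⁻ y, v k y ∂ν) + ∑ i ∈ Finset.range N, M * ∫⁻ y, v i y ∂ν := by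
        gcongr with i hi
        exact inner i (Finset.mem_range.1 hi)
    _ = (1 + M) * ∑ k ∈ Finset.range N, ∫⁻ y, v k y ∂ν := by
        rw [← Finset.mul_sum]; ring

lemma packingWeight_maximal {H : ℕ → Finset G} {E : ℕ → Set Y}
    (hH : ∀ k, (H k).Nonempty) (hE : ∀ k, MeasurableSet (E k))
    (hdisj : Pairwise (Function.onFun Disjoint E)) {M : ℝ≥0∞} {N : ℕ}
    (htemp : ∀ i < N, ((((Finset.Ioo i N).biUnion fun j => (H j)⁻¹ * H i).card : ℕ) : ℝ≥0∞)
      ≤ M * (H i).card)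
    {f : Y → ℝ≥0∞} (hf : Measurable f) {c : ℝ≥0∞}
    (hc : ∀ k, ∀ y ∈ E k, c ≤ ∑ g ∈ H k, f (g • y) / (H k).card) :
    c * ∑ k ∈ Finset.range N, ν (E k) ≤ (1 + M) * ∫⁻ y, f y ∂ν := by
  have hvm := measurable_packingWeight H hE
  set v := packingWeight H E with hv
  have h1 : ∀ k, c * ∫⁻ y, v k y ∂ν
      ≤ ∑ g ∈ H k, ∫⁻ y, f y * (v k (g⁻¹ • y) / (H k).card) ∂ν := by
    intro k
    have hm : ∀ g : G, Measurable fun y => f y * (v k (g⁻¹ • y) / (H k).card) := fun g =>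
      hf.mul (((hvm k).comp (measurable_const_smul g⁻¹)).div_const _)
    have e : ∀ g : G, ∫⁻ y, f y * (v k (g⁻¹ • y) / (H k).card) ∂ν
        = ∫⁻ y, f (g • y) * (v k y / (H k).card) ∂ν := fun g => by
      rw [← (measurePreserving_smul g ν).lintegral_comp (hm g)]
      simp
    simp_rw [e]
    have hm' : ∀ g ∈ H k, Measurable fun y => f (g • y) * (v k y / (H k).card) := fun g _ =>
      (hf.comp (measurable_const_smul g)).mul ((hvm k).div_const _)
    rw [← lintegral_finsetSum _ hm', ← lintegral_const_mul _ (hvm k)]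
    refine lintegral_mono fun y => ?_
    by_cases hy : y ∈ E k
    · calc c * v k y ≤ (∑ g ∈ H k, f (g • y) / (H k).card) * v k y := by
            gcongr; exact hc k y hy
        _ = _ := by
            rw [Finset.sum_mul]
            refine Finset.sum_congr rfl fun g _ => ?_
            simp only [div_eq_mul_inv]; ring
    · have : v k y = 0 := by
        rw [hv, packingWeight_eq]; exact Set.indicator_of_notMem hy _
      simp [this]
  calc c * ∑ k ∈ Finset.range N, ν (E k)
      ≤ c * ((1 + M) * ∑ k ∈ Finset.range N, ∫⁻ y, v k y ∂ν) := by
        gcongr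
        exact sum_measure_le_packingWeight hH hE hdisj htemp
    _ = (1 + M) * ∑ k ∈ Finset.range N, c * ∫⁻ y, v k y ∂ν := by
        rw [← Finset.mul_sum]; ring
    _ ≤ (1 + M) * ∑ k ∈ Finset.range N,
          ∑ g ∈ H k, ∫⁻ y, f y * (v k (g⁻¹ • y) / (H k).card) ∂ν := by
        gcongr with k _
        exact h1 k
    _ = (1 + M) * ∫⁻ y, f y * ∑ k ∈ Finset.range N,
          ∑ g ∈ H k, v k (g⁻¹ • y) / (H k).card ∂ν := by
        have hm : ∀ k, ∀ g : G, Measurable fun y => f y * (v k (g⁻¹ • y) / (H k).card) :=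
          fun k g => hf.mul (((hvm k).comp (measurable_const_smul g⁻¹)).div_const _)
        congr 1
        simp_rw [Finset.mul_sum]
        rw [lintegral_finsetSum _ (fun k _ => Finset.measurable_fun_sum _ fun g _ => hm k g)]
        simp_rw [lintegral_finsetSum _ (fun g _ => hm _ g)]
    _ ≤ (1 + M) * ∫⁻ y, f y ∂ν := by
        gcongr with y
        exact mul_le_of_le_one_right' (packingWeight_multiplicity_le_one E N y)

lemma maximal_ineq_of_tempered_finite {F : ℕ → Finset G} (hF : ∀ n, (F n).Nonempty) {M : ℝ≥0∞}
    (htemp : ∀ n, ((((Finset.range (n + 1)).biUnion fun k => (F k)⁻¹ * F (n + 1)).card : ℕ) : ℝ≥0∞)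
      ≤ M * (F (n + 1)).card)
    {f : Y → ℝ≥0∞} (hf : Measurable f) (c : ℝ≥0∞) (N : ℕ) :
    c * ν {y | ∃ n < N, c ≤ ∑ g ∈ F n, f (g • y) / (F n).card} ≤ (1 + M) * ∫⁻ y, f y ∂ν := by
  set H : ℕ → Finset G := fun k => F (N - 1 - k) with hH
  set S : ℕ → Set Y := fun k => {y | c ≤ ∑ g ∈ H k, f (g • y) / (H k).card} with hS
  have hSm : ∀ k, MeasurableSet (S k) := fun k =>
    measurableSet_le measurable_const (Finset.measurable_fun_sum _ fun g _ =>
      (hf.comp (measurable_const_smul g)).div_const _)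
  have main := packingWeight_maximal (ν := ν) (H := H) (E := disjointed S) (M := M) (N := N)
    (fun k => hF _) (fun k => MeasurableSet.disjointed hSm k) (disjoint_disjointed S) (by
      intro i hi
      rcases Nat.eq_zero_or_pos (N - 1 - i) with h0 | hpos
      · have : Finset.Ioo i N = ∅ := by
          ext j; simp only [Finset.mem_Ioo, Finset.notMem_empty, iff_false]; omega
        simp [this]
      · obtain ⟨n, hn⟩ := Nat.exists_eq_succ_of_ne_zero hpos.ne'
        have e : H i = F (n + 1) := by simp only [hH, hn]
        rw [e]
        refine le_trans ?_ (htemp n)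
        gcongr
        refine Finset.biUnion_subset.2 fun j hj => ?_
        rw [Finset.mem_Ioo] at hj
        exact Finset.subset_biUnion_of_mem (fun k => (F k)⁻¹ * F (n + 1))
          (Finset.mem_range.2 (by omega)))
    hf (c := c) (fun k y hy => disjointed_subset S k hy)
  refine le_trans ?_ main
  gcongr
  refine le_trans (measure_mono ?_) (measure_biUnion_finset_le _ _)
  rintro y ⟨n, hn, hy⟩
  have hex : ∃ k, y ∈ S k := ⟨N - 1 - n, by
    have : N - 1 - (N - 1 - n) = n := by omega
    simpa [hS, hH, this] using hy⟩
  classical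
  have hle : Nat.find hex ≤ N - 1 - n := Nat.find_min' hex (by
    have : N - 1 - (N - 1 - n) = n := by omega
    simpa [hS, hH, this] using hy)
  refine Set.mem_iUnion₂.2 ⟨Nat.find hex, Finset.mem_range.2 (by omega), ?_⟩
  rw [disjointed_apply, Finset.sup_eq_iSup]
  refine ⟨Nat.find_spec hex, ?_⟩
  simp only [Set.iSup_eq_iUnion, Set.mem_iUnion, not_exists]
  exact fun j hj => Nat.find_min hex (by simpa using hj)

/-- The weak-type `(1, 1)` maximal inequality for averages along a tempered sequence. -/
lemma maximal_ineq_of_tempered {F : ℕ → Finset G} (hF : ∀ n, (F n).Nonempty) {M : ℝ≥0∞}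
    (htemp : ∀ n, ((((Finset.range (n + 1)).biUnion fun k => (F k)⁻¹ * F (n + 1)).card : ℕ) : ℝ≥0∞)
      ≤ M * (F (n + 1)).card)
    {f : Y → ℝ≥0∞} (hf : Measurable f) (c : ℝ≥0∞) :
    c * ν {y | ∃ n, c ≤ ∑ g ∈ F n, f (g • y) / (F n).card} ≤ (1 + M) * ∫⁻ y, f y ∂ν := by
  have : {y | ∃ n, c ≤ ∑ g ∈ F n, f (g • y) / (F n).card}
      = ⋃ N : ℕ, {y | ∃ n < N, c ≤ ∑ g ∈ F n, f (g • y) / (F n).card} := by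
    ext y
    simp only [Set.mem_ofPred_eq, Set.mem_iUnion]
    exact ⟨fun ⟨n, hn⟩ => ⟨n + 1, n, n.lt_succ_self, hn⟩, fun ⟨_, n, _, hn⟩ => ⟨n, hn⟩⟩
  rw [this, Monotone.measure_iUnion, ENNReal.mul_iSup]
  · exact iSup_le fun N => maximal_ineq_of_tempered_finite hF htemp hf c N
  · exact fun a b hab y ⟨n, hn, hy⟩ => ⟨n, hn.trans_le hab, hy⟩

end MaximalInequality

section ErgodicTheorem

variable {G Y : Type*} [Group G] [MulAction G Y]

/-- The average of `f` over the translates of `y` by the elements of `A`. -/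
noncomputable def orbitAverage (A : Finset G) (f : Y → ℝ) (y : Y) : ℝ :=
  (∑ g ∈ A, f (g • y)) / (A.card : ℝ)

lemma orbitAverage_add (A : Finset G) (f g : Y → ℝ) (y : Y) :
    orbitAverage A (f + g) y = orbitAverage A f y + orbitAverage A g y := by
  simp [orbitAverage, Finset.sum_add_distrib, add_div]

lemma orbitAverage_smul (A : Finset G) (c : ℝ) (f : Y → ℝ) (y : Y) :
    orbitAverage A (c • f) y = c * orbitAverage A f y := by
  simp [orbitAverage, ← Finset.mul_sum, mul_div_assoc]

lemma orbitAverage_sub (A : Finset G) (f g : Y → ℝ) (y : Y) :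
    orbitAverage A (f - g) y = orbitAverage A f y - orbitAverage A g y := by
  simp [orbitAverage, Finset.sum_sub_distrib, sub_div]

lemma enorm_orbitAverage_le (A : Finset G) (f : Y → ℝ) (y : Y) :
    ‖orbitAverage A f y‖ₑ ≤ ∑ g ∈ A, ‖f (g • y)‖ₑ / A.card := by
  rcases A.eq_empty_or_nonempty with rfl | hA
  · simp [orbitAverage]
  · have hc : (A.card : ℝ) ≠ 0 := by simpa using hA.ne_empty
    rw [orbitAverage, div_eq_mul_inv, enorm_mul, enorm_inv hc]
    simp_rw [div_eq_mul_inv, ← Finset.sum_mul]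
    rw [Real.enorm_natCast]
    gcongr
    exact enorm_sum_le _ _

variable [MeasurableSpace Y]

/-- The averages of `f` along `F` converge almost everywhere to the conditional expectation of
`f` on the invariant sets. -/
def AverageConverges (ν : Measure Y) (F : ℕ → Finset G) (f : Y → ℝ) : Prop :=
  ∀ᵐ y ∂ν, Tendsto (fun n => orbitAverage (F n) f y) atTop (𝓝 ((ν[f | invSigma G ν]) y))

variable {ν : Measure Y} {F : ℕ → Finset G}

lemma AverageConverges.add {f g : Y → ℝ} (hfi : Integrable f ν) (hgi : Integrable g ν)
    (hf : AverageConverges ν F f) (hg : AverageConverges ν F g) :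
    AverageConverges ν F (f + g) := by
  filter_upwards [hf, hg, condExp_add hfi hgi (invSigma G ν)] with y h1 h2 h3
  rw [h3]
  simp_rw [orbitAverage_add]
  exact h1.add h2

lemma AverageConverges.const_smul {f : Y → ℝ} (hf : AverageConverges ν F f) (c : ℝ) :
    AverageConverges ν F (c • f) := by
  filter_upwards [hf, condExp_smul c f (invSigma G ν)] with y h1 h3
  rw [h3]
  simp_rw [orbitAverage_smul]
  exact h1.const_mul c

variable [MeasurableConstSMul G Y] [SMulInvariantMeasure G Y ν]

lemma averageConverges_indicator_sub_comp_smul [DecidableEq G] [IsFiniteMeasure ν]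
    (hF : IsFolner F) {D : Set Y} (hD : MeasurableSet D) (g : G) :
    AverageConverges ν F
      (D.indicator 1 - fun y => D.indicator (1 : Y → ℝ) (g • y)) := by
  have hi : Integrable (D.indicator (1 : Y → ℝ)) ν := (integrable_const 1).indicator hD
  have hi' := (measurePreserving_smul g ν).integrable_comp_of_integrable hi
  filter_upwards [condExp_sub hi hi' (invSigma G ν), condExp_invSigma_comp_smul hi g] with y h1 h2
  have h3 : (ν[D.indicator 1 - fun y => D.indicator (1 : Y → ℝ) (g • y) | invSigma G ν]) y = 0 := by
    refine h1.trans ?_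
    rw [Pi.sub_apply, sub_eq_zero]
    exact h2.symm
  rw [h3]
  refine squeeze_zero_norm (fun n => ?_) (hF.2 g)
  have hc : (0 : ℝ) ≤ (F n).card := Nat.cast_nonneg _
  rw [orbitAverage, norm_div, Real.norm_of_nonneg hc]
  gcongr
  set φ : G → ℝ := fun k => D.indicator 1 (k • y) with hφ
  have hφ1 : ∀ k, ‖φ k‖ ≤ 1 := fun k => by
    refine (norm_indicator_le_norm_self _ _).trans ?_
    simp
  have e1 : ∑ k ∈ F n, (D.indicator 1 - fun y => D.indicator 1 (g • y) : Y → ℝ) (k • y)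
      = ∑ k ∈ F n, φ k - ∑ k ∈ (F n).image (g * ·), φ k := by
    rw [Finset.sum_image fun a _ b _ h => by simpa using h, ← Finset.sum_sub_distrib]
    simp [hφ, mul_smul]
  rw [e1, ← Finset.sum_sdiff_sub_sum_sdiff, symmDiff_comm]
  change _ ≤ ((((F n) \ (F n).image (g * ·)) ∪ ((F n).image (g * ·) \ F n)).card : ℝ)
  rw [Finset.card_union_of_disjoint disjoint_sdiff_sdiff, Nat.cast_add]
  refine (norm_sub_le _ _).trans (add_le_add ?_ ?_)
  · exact (norm_sum_le_of_le _ fun k _ => hφ1 k).trans_eq (by simp)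
  · exact (norm_sum_le_of_le _ fun k _ => hφ1 k).trans_eq (by simp)

variable [Countable G]

lemma ae_forall_smul {p : Y → Prop} (h : ∀ᵐ y ∂ν, p y) : ∀ᵐ y ∂ν, ∀ g : G, p (g • y) :=
  ae_all_iff.2 fun g => (measurePreserving_smul g ν).quasiMeasurePreserving.ae h

lemma AverageConverges.congr {f g : Y → ℝ} (hf : AverageConverges ν F f) (hfg : f =ᵐ[ν] g) :
    AverageConverges ν F g := by
  filter_upwards [hf, condExp_congr_ae (m := invSigma G ν) hfg, ae_forall_smul (G := G) hfg]
    with y h1 h2 h3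
  rw [← h2]
  simpa only [orbitAverage, h3] using h1

lemma averageConverges_of_invariant [IsFiniteMeasure ν] (hF : ∀ n, (F n).Nonempty) {f : Y → ℝ}
    (hfi : Integrable f ν) (hf : ∀ g : G, (fun y => f (g • y)) =ᵐ[ν] f) :
    AverageConverges ν F f := by
  have h0 := hfi.1.ae_eq_mk
  set f' := hfi.1.mk f with hf'
  have hm : Measurable f' := hfi.1.stronglyMeasurable_mk.measurable
  have hinv : ∀ g : G, (fun y => f' (g • y)) =ᵐ[ν] f' := fun g => by
    filter_upwards [hf g, h0, ae_forall_smul (G := G) h0] with y h1 h2 h3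
    rw [← h3 g, ← h2]; exact h1
  refine AverageConverges.congr (f := f') ?_ h0.symm
  have hE : ν[f' | invSigma G ν] = f' := condExp_of_stronglyMeasurable (invSigma_le G ν)
    (measurable_invSigma_of_comp_smul_ae_eq hm hinv).stronglyMeasurable (hfi.congr h0)
  unfold AverageConverges
  rw [hE]
  filter_upwards [ae_all_iff.2 hinv] with y hy
  have : ∀ n, orbitAverage (F n) f' y = f' y := fun n => by
    have hc : ((F n).card : ℝ) ≠ 0 := by simpa using (hF n).ne_empty
    simp only [orbitAverage, hy, Finset.sum_const, nsmul_eq_mul]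
    field_simp
  simp [this]

end ErgodicTheorem

section ErgodicTheorem

variable {G Y : Type*} [Group G] [MulAction G Y] [MeasurableSpace Y]
variable {ν : Measure Y} {F : ℕ → Finset G}
variable [Countable G] [MeasurableConstSMul G Y] [SMulInvariantMeasure G Y ν]

lemma averageConverges_of_approx [DecidableEq G] [IsFiniteMeasure ν] (hF : ∀ n, (F n).Nonempty)
    (htemp : IsTempered F) {f : Y → ℝ} (hf : Integrable f ν)
    (happ : ∀ ε : ℝ≥0∞, ε ≠ 0 → ∃ g : Y → ℝ, Integrable g ν ∧ AverageConverges ν F g ∧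
      eLpNorm (f - g) 1 ν ≤ ε) :
    AverageConverges ν F f := by
  obtain ⟨M', hM', htemp'⟩ := htemp
  set M : ℝ≥0∞ := ENNReal.ofReal M' with hM
  have htM : ∀ n, ((((Finset.range (n + 1)).biUnion fun k => (F k)⁻¹ * F (n + 1)).card : ℕ) :
      ℝ≥0∞) ≤ M * (F (n + 1)).card := fun n => by
    have := ENNReal.ofReal_le_ofReal (htemp' n)
    rwa [ENNReal.ofReal_mul hM'.le, ENNReal.ofReal_natCast, ENNReal.ofReal_natCast] at this
  have key : ∀ δ : ℝ≥0∞, δ ≠ 0 → δ ≠ ⊤ → ∀ᵐ y ∂ν, ∀ᶠ n in atTop,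
      ‖orbitAverage (F n) f y - (ν[f | invSigma G ν]) y‖ₑ ≤ 3 * δ := by
    intro δ hδ hδt
    rw [ae_iff]
    set B := {y | ¬ ∀ᶠ n in atTop, ‖orbitAverage (F n) f y - (ν[f | invSigma G ν]) y‖ₑ ≤ 3 * δ}
      with hB
    have hbound : ∀ ε : ℝ≥0∞, ε ≠ 0 → ν B ≤ (2 + M) * ε / δ := by
      intro ε hε
      obtain ⟨g, hgi, hg, hfg⟩ := happ ε hε
      set r := f - g with hr
      have hri : Integrable r ν := hf.sub hgi
      set u : Y → ℝ≥0∞ := fun y => ‖hri.1.mk r y‖ₑ with hu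
      have hum : Measurable u := hri.1.stronglyMeasurable_mk.measurable.enorm
      have hru : ∀ᵐ y ∂ν, ‖r y‖ₑ = u y := by
        filter_upwards [hri.1.ae_eq_mk] with y hy
        exact congrArg _ hy
      set B1 := {y | ∃ n, δ ≤ ∑ g ∈ F n, u (g • y) / (F n).card} with hB1
      set B2 := {y | δ ≤ ‖(ν[r | invSigma G ν]) y‖ₑ} with hB2
      have hsub : B ≤ᵐ[ν] (B1 ∪ B2 : Set Y) := by
        filter_upwards [hg, ae_forall_smul (G := G) hru, condExp_sub hf hgi (invSigma G ν)]
          with y h1 h2 h3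
        intro hy
        by_contra hcon
        change ¬ (y ∈ B1 ∨ y ∈ B2) at hcon
        rw [not_or] at hcon
        obtain ⟨hc1, hc2⟩ := hcon
        simp only [hB1, Set.mem_ofPred_eq, not_exists, not_le] at hc1
        simp only [hB2, Set.mem_ofPred_eq, not_le] at hc2
        refine hy ?_
        have h4 : Tendsto (fun n => ‖orbitAverage (F n) g y - (ν[g | invSigma G ν]) y‖ₑ) atTop
            (𝓝 0) := by
          have := (h1.sub_const ((ν[g | invSigma G ν]) y)).enorm
          simpa using this
        filter_upwards [h4.eventually_le_const (pos_iff_ne_zero.2 hδ)] with n hn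
        have h5 : orbitAverage (F n) f y - (ν[f | invSigma G ν]) y
            = (orbitAverage (F n) g y - (ν[g | invSigma G ν]) y) + orbitAverage (F n) r y
              - (ν[r | invSigma G ν]) y := by
          rw [hr, orbitAverage_sub]
          have : (ν[f - g | invSigma G ν]) y
              = (ν[f | invSigma G ν]) y - (ν[g | invSigma G ν]) y := h3
          rw [this]; ring
        rw [h5]
        calc _ ≤ ‖orbitAverage (F n) g y - (ν[g | invSigma G ν]) y‖ₑ + ‖orbitAverage (F n) r y‖ₑ
                + ‖(ν[r | invSigma G ν]) y‖ₑ :=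
              (enorm_sub_le).trans (add_le_add_left (enorm_add_le _ _) _)
          _ ≤ δ + δ + δ := by
              gcongr
              refine (enorm_orbitAverage_le _ _ _).trans ?_
              simp_rw [h2]
              exact (hc1 n).le
          _ = 3 * δ := by ring
      have hu1 : ∫⁻ y, u y ∂ν ≤ ε := by
        rw [← lintegral_congr_ae hru, ← eLpNorm_one_eq_lintegral_enorm]
        exact hfg
      have hb1 : ν B1 ≤ (1 + M) * ε / δ := by
        rw [ENNReal.le_div_iff_mul_le (Or.inl hδ) (Or.inl hδt), mul_comm]
        exact (maximal_ineq_of_tempered hF htM hum δ).trans (by gcongr)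
      have hb2 : ν B2 ≤ ε / δ := by
        refine (meas_ge_le_lintegral_div
          (stronglyMeasurable_condExp.mono (invSigma_le G ν)).measurable.enorm.aemeasurable
          hδ hδt).trans ?_
        gcongr
        rw [← eLpNorm_one_eq_lintegral_enorm]
        exact (eLpNorm_condExp_le_eLpNorm _ le_rfl).trans hfg
      calc ν B ≤ ν (B1 ∪ B2) := measure_mono_ae hsub
        _ ≤ ν B1 + ν B2 := measure_union_le _ _
        _ ≤ (1 + M) * ε / δ + ε / δ := add_le_add hb1 hb2
        _ = (2 + M) * ε / δ := by
          rw [← ENNReal.add_div]; congr 1; ring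
    have hC : (2 + M) / δ ≠ ⊤ := ENNReal.div_ne_top (by simp [hM]) hδ
    refine le_antisymm (ENNReal.le_of_forall_pos_le_add fun η hη _ => ?_) zero_le
    rw [zero_add]
    obtain ⟨ε, hε, hε'⟩ := ENNReal.exists_nnreal_pos_mul_lt hC (ENNReal.coe_pos.2 hη).ne'
    refine (hbound ε (by simpa using hε.ne')).trans ?_
    rw [mul_comm, mul_div_assoc]
    exact hε'.le
  have key' : ∀ k : ℕ, ∀ᵐ y ∂ν, ∀ᶠ n in atTop,
      ‖orbitAverage (F n) f y - (ν[f | invSigma G ν]) y‖ₑ ≤ 3 * ((k : ℝ≥0∞) + 1)⁻¹ := fun k =>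
    key _ (by simp) (by simp)
  filter_upwards [ae_all_iff.2 key'] with y hy
  rw [tendsto_iff_edist_tendsto_0]
  simp_rw [edist_eq_enorm_sub]
  refine ENNReal.tendsto_nhds_zero.2 fun ε hε => ?_
  obtain ⟨k, hk⟩ := ENNReal.exists_inv_nat_lt (a := ε / 3) (by simpa using hε.ne')
  filter_upwards [hy k] with n hn
  refine hn.trans ?_
  rw [mul_comm]
  refine ENNReal.mul_le_of_le_div ((ENNReal.inv_le_inv.2 le_self_add).trans hk.le)

/-- The square-integrable functions whose averages converge. -/
def averageConvergesSubmodule [IsFiniteMeasure ν] (F : ℕ → Finset G) :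
    Submodule ℝ (Lp ℝ 2 ν) where
  carrier := {f | AverageConverges ν F f}
  add_mem' {f g} hf hg :=
    (hf.add ((Lp.memLp f).integrable one_le_two) ((Lp.memLp g).integrable one_le_two) hg).congr
      (Lp.coeFn_add f g).symm
  zero_mem' := AverageConverges.congr (f := 0) (by
    filter_upwards with y
    simp [orbitAverage]) (Lp.coeFn_zero ℝ 2 ν).symm
  smul_mem' c f hf := (AverageConverges.const_smul hf c).congr (Lp.coeFn_smul c f).symm

lemma averageConvergesSubmodule_orthogonal [DecidableEq G] [IsFiniteMeasure ν] (hF : IsFolner F) :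
    (averageConvergesSubmodule (ν := ν) F)ᗮ = ⊥ := by
  rw [Submodule.eq_bot_iff]
  intro w hw
  have hwi : Integrable w ν := (Lp.memLp w).integrable one_le_two
  have hinv : ∀ g : G, (fun y => w (g • y)) =ᵐ[ν] w := by
    intro g
    have hmp := measurePreserving_smul g ν
    refine Integrable.ae_eq_of_forall_setIntegral_eq _ _
      (hmp.integrable_comp_of_integrable hwi) hwi fun D hD _ => ?_
    set φ : Y → ℝ := D.indicator 1 - fun y => D.indicator 1 (g⁻¹ • y) with hφ
    have hi : MemLp (D.indicator (1 : Y → ℝ)) 2 ν := (memLp_const 1).indicator hD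
    have hi' : MemLp (fun y => D.indicator (1 : Y → ℝ) (g⁻¹ • y)) 2 ν :=
      hi.comp_measurePreserving (measurePreserving_smul g⁻¹ ν)
    have hφL : MemLp φ 2 ν := hi.sub hi'
    have hmem : hφL.toLp φ ∈ averageConvergesSubmodule (ν := ν) F :=
      (averageConverges_indicator_sub_comp_smul hF hD g⁻¹).congr hφL.coeFn_toLp.symm
    have h0 := hw _ hmem
    rw [L2.inner_def] at h0
    have h1 : ∫ y, w y * φ y ∂ν = 0 := by
      rw [← h0]
      refine integral_congr_ae ?_
      filter_upwards [hφL.coeFn_toLp] with y hy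
      rw [hy]; simp
    have h2 : ∫ y, w y * D.indicator 1 y ∂ν = ∫ y in D, w y ∂ν := by
      rw [← integral_indicator hD]
      congr 1; ext y; by_cases hy : y ∈ D <;> simp [hy]
    have h3 : ∫ y, w y * D.indicator 1 (g⁻¹ • y) ∂ν = ∫ y in D, w (g • y) ∂ν := by
      rw [← integral_indicator hD, ← hmp.integral_comp (measurableEmbedding_const_smul g)]
      congr 1; ext y; by_cases hy : y ∈ D <;> simp [hy]
    rw [← h2, ← h3]
    have hA : Integrable (fun y => w y * D.indicator 1 y) ν := (Lp.memLp w).integrable_mul hi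
    have hB : Integrable (fun y => w y * D.indicator 1 (g⁻¹ • y)) ν :=
      (Lp.memLp w).integrable_mul hi'
    have h4 := integral_sub hA hB
    rw [← sub_eq_zero, ← neg_eq_zero, neg_sub, ← h4, ← h1]
    congr 1; ext y; simp [hφ, mul_sub]
  have : w ∈ averageConvergesSubmodule (ν := ν) F := averageConverges_of_invariant hF.1 hwi hinv
  exact inner_self_eq_zero.1 (hw w this)

/-- Lindenstrauss' pointwise ergodic theorem along a tempered Følner sequence. -/
theorem averageConverges_of_integrable [DecidableEq G] [IsProbabilityMeasure ν] (hF : IsFolner F)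
    (htemp : IsTempered F) {f : Y → ℝ} (hf : Integrable f ν) : AverageConverges ν F f := by
  have hL2 : ∀ f : Lp ℝ 2 ν, AverageConverges ν F f := by
    intro f
    refine averageConverges_of_approx hF.1 htemp ((Lp.memLp f).integrable one_le_two)
      fun ε hε => ?_
    have hdense : f ∈ closure (averageConvergesSubmodule (ν := ν) F : Set (Lp ℝ 2 ν)) := by
      rw [← Submodule.topologicalClosure_coe, (Submodule.topologicalClosure_eq_top_iff).2
        (averageConvergesSubmodule_orthogonal hF)]
      trivial
    obtain ⟨g, hg, hfg⟩ := EMetric.mem_closure_iff.1 hdense ε (pos_iff_ne_zero.2 hε)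
    refine ⟨g, (Lp.memLp g).integrable one_le_two, hg, ?_⟩
    rw [Lp.edist_def] at hfg
    exact (eLpNorm_le_eLpNorm_of_exponent_le one_le_two
      ((Lp.aestronglyMeasurable f).sub (Lp.aestronglyMeasurable g))).trans hfg.le
  refine averageConverges_of_approx hF.1 htemp hf fun ε hε => ?_
  obtain ⟨g, hg, _⟩ := (memLp_one_iff_integrable.2 hf).exists_simpleFunc_eLpNorm_sub_lt
    ENNReal.one_ne_top hε
  have hg2 : MemLp g 2 ν := g.memLp_of_isFiniteMeasure 2 ν
  exact ⟨g, hg2.integrable one_le_two, (hL2 (hg2.toLp g)).congr hg2.coeFn_toLp, hg.le⟩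

end ErgodicTheorem

section Tilings

lemma sum_le_of_superadditive_s5 {G : Type*} [DecidableEq G] {φ : Finset G → ℝ} (h0 : φ ∅ = 0)
    (hnn : ∀ A, 0 ≤ φ A)
    (hsup : ∀ A B, Disjoint A B → φ A + φ B ≤ φ (A ∪ B)) {ι : Type*} [DecidableEq ι]
    {I : Finset ι} {P : ι → Finset G} (hP : (I : Set ι).PairwiseDisjoint P) {A : Finset G}
    (hA : ∀ i ∈ I, P i ⊆ A) : ∑ i ∈ I, φ (P i) ≤ φ A := by
  have h1 : ∑ i ∈ I, φ (P i) ≤ φ (I.biUnion P) := by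
    clear hA
    induction I using Finset.induction_on with
    | empty => simp [h0]
    | insert i I hi ih =>
      rw [Finset.sum_insert hi, Finset.biUnion_insert]
      refine (add_le_add_right (ih (hP.subset (by simp))) _).trans (hsup _ _ ?_)
      rw [Finset.disjoint_biUnion_right]
      exact fun j hj => hP (by simp) (by simp [hj]) (fun h => hi (h ▸ hj))
  refine h1.trans ?_
  have h2 := hsup (I.biUnion P) (A \ I.biUnion P) Finset.disjoint_sdiff
  rw [Finset.union_sdiff_of_subset (Finset.biUnion_subset.2 hA)] at h2
  linarith [hnn (A \ I.biUnion P)]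

variable {G : Type*} [Group G] [DecidableEq G]

/-- A tiling by `T` writes every `g : G` as `τ g * γ g` with `τ g ∈ T`, in such a way that the
translates `τ g * T * γ g` with the same value of `τ` are pairwise disjoint. -/
lemma Tiles.exists_decomposition {T : Finset G} (hT : Tiles T) :
    ∃ τ γ : G → G, (∀ g, τ g ∈ T) ∧ (∀ g, τ g * γ g = g) ∧
      ∀ g g', τ g = τ g' → g ≠ g' →
        Disjoint (T.image fun s => τ g * s * γ g) (T.image fun s => τ g' * s * γ g') := by
  obtain ⟨-, C, hC⟩ := hT
  choose γ hγ _ using fun x => (hC x).exists.imp fun c hc => And.intro hc trivial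
  choose hγC τ hτ hτγ using hγ
  refine ⟨τ, γ, hτ, fun g => (hτγ g).symm, fun g g' hgg' hne => ?_⟩
  rw [Finset.disjoint_left]
  intro x hx hx'
  obtain ⟨s, hs, rfl⟩ := Finset.mem_image.1 hx
  obtain ⟨s', hs', he⟩ := Finset.mem_image.1 hx'
  have he' : s' * γ g' = s * γ g := by
    rw [hgg', mul_assoc, mul_assoc] at he
    exact mul_left_cancel he
  have : γ g = γ g' := (hC (s * γ g)).unique ⟨hγC g, s, hs, rfl⟩ ⟨hγC g', s', hs', he'.symm⟩
  exact hne (by rw [hτγ g, hτγ g', hgg', this])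

lemma card_filter_not_subset_le {T : Finset G} {τ γ : G → G} (hτ : ∀ g, τ g ∈ T)
    (hτγ : ∀ g, τ g * γ g = g) (A : Finset G) :
    (A.filter fun g => ¬ (T.image fun s => τ g * s * γ g) ⊆ A).card
      ≤ ∑ k ∈ T * T * T⁻¹, ((A.image (k * ·)) ∆ A).card := by
  have hsub : (A.filter fun g => ¬ (T.image fun s => τ g * s * γ g) ⊆ A)
      ⊆ (T * T * T⁻¹).biUnion fun k => A.filter fun g => k * g ∉ A := by
    intro g hg
    obtain ⟨hgA, hg⟩ := Finset.mem_filter.1 hg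
    obtain ⟨x, hx, hxA⟩ := Finset.not_subset.1 hg
    obtain ⟨s, hs, rfl⟩ := Finset.mem_image.1 hx
    refine Finset.mem_biUnion.2 ⟨τ g * s * (τ g)⁻¹, Finset.mul_mem_mul
      (Finset.mul_mem_mul (hτ g) hs) (Finset.inv_mem_inv (hτ g)), Finset.mem_filter.2 ⟨hgA, ?_⟩⟩
    have : τ g * s * (τ g)⁻¹ * g = τ g * s * γ g := by
      rw [eq_inv_mul_of_mul_eq (hτγ g)]
      simp only [mul_assoc]
    rwa [this]
  refine (Finset.card_le_card hsub).trans (Finset.card_biUnion_le.trans ?_)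
  refine Finset.sum_le_sum fun k _ => ?_
  rw [← Finset.card_image_of_injective _ (mul_right_injective k)]
  refine Finset.card_le_card fun x hx => ?_
  obtain ⟨g, hg, rfl⟩ := Finset.mem_image.1 hx
  obtain ⟨hgA, hg⟩ := Finset.mem_filter.1 hg
  exact Finset.mem_symmDiff.2 (Or.inl ⟨Finset.mem_image_of_mem _ hgA, hg⟩)

lemma IsFolner.tendsto_card_filter_not_subset {F : ℕ → Finset G} (hF : IsFolner F)
    {T : Finset G} {τ γ : G → G} (hτ : ∀ g, τ g ∈ T) (hτγ : ∀ g, τ g * γ g = g) :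
    Tendsto (fun n => (((F n).filter fun g =>
      ¬ (T.image fun s => τ g * s * γ g) ⊆ F n).card : ℝ) / ((F n).card : ℝ)) atTop (𝓝 0) := by
  have h := tendsto_finsetSum (T * T * T⁻¹) fun k _ => hF.2 k
  rw [Finset.sum_const_zero] at h
  refine squeeze_zero (fun n => by positivity) (fun n => ?_) h
  rw [← Finset.sum_div]
  gcongr
  exact_mod_cast card_filter_not_subset_le hτ hτγ (F n)

end Tilings

section Superadditive

variable {G Y : Type*} [Group G] [DecidableEq G] [MulAction G Y] [MeasurableSpace Y]

/-- A non-negative super-additive `G`-bi-invariant family of integrable functions. -/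
structure IsSuperadditiveFamily (ν : Measure Y) (S : Finset G → Y → ℝ) : Prop where
  empty : ∀ y, S ∅ y = 0
  integrable : ∀ A : Finset G, Integrable (S A) ν
  nonneg : ∀ A : Finset G, ∀ᵐ y ∂ν, 0 ≤ S A y
  invariant : ∀ A : Finset G, ∀ g : G, ∀ᵐ y ∂ν, S (A.image (· * g)) y = S A (g • y)
  biinvariant : ∀ A : Finset G, ∀ g : G, ∀ᵐ y ∂ν, S (A.image (g * ·)) y = S (A.image (· * g)) y
  superadditive : ∀ A B : Finset G, Disjoint A B → ∀ᵐ y ∂ν, S A y + S B y ≤ S (A ∪ B) y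

lemma measurable_iSup_condExp {G Y : Type*} [Group G] [Countable G] [MulAction G Y]
    [MeasurableSpace Y] {ν : Measure Y} (S : Finset G → Y → ℝ) :
    Measurable[invSigma G ν] fun y => ⨆ T ∈ {T : Finset G | Tiles T},
      ENNReal.ofReal ((T.card : ℝ)⁻¹ * (ν[S T | invSigma G ν]) y) := by
  let := invSigma G ν
  refine Measurable.biSup _ (Set.to_countable _) fun T _ => ?_
  exact ENNReal.measurable_ofReal.comp (stronglyMeasurable_condExp.measurable.const_mul _)

variable {ν : Measure Y} {S : Finset G → Y → ℝ}

namespace IsSuperadditiveFamily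

lemma setLIntegral_ofReal_condExp [IsProbabilityMeasure ν] (hS : IsSuperadditiveFamily ν S)
    (A : Finset G) {c : ℝ}
    (hc : 0 ≤ c) {D : Set Y} (hD : MeasurableSet[invSigma G ν] D) :
    ∫⁻ y in D, ENNReal.ofReal (c * S A y) ∂ν
      = ∫⁻ y in D, ENNReal.ofReal (c * (ν[S A | invSigma G ν]) y) ∂ν := by
  simp_rw [ENNReal.ofReal_mul hc]
  rw [lintegral_const_mul' _ _ ENNReal.ofReal_ne_top,
    lintegral_const_mul' _ _ ENNReal.ofReal_ne_top,
    ← ofReal_integral_eq_lintegral_ofReal (hS.integrable A).integrableOn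
      (ae_restrict_of_ae (hS.nonneg A)),
    ← ofReal_integral_eq_lintegral_ofReal integrable_condExp.integrableOn
      (ae_restrict_of_ae (condExp_nonneg (hS.nonneg A))),
    setIntegral_condExp (invSigma_le G ν) (hS.integrable A) hD]

lemma setLIntegral_liminf_le [IsProbabilityMeasure ν] {F : ℕ → Finset G}
    (hS : IsSuperadditiveFamily ν S) {D : Set Y}
    (hD : MeasurableSet[invSigma G ν] D) :
    ∫⁻ y in D, liminf (fun n => ENNReal.ofReal (S (F n) y / (F n).card)) atTop ∂ν
      ≤ liminf (fun n => ∫⁻ y in D,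
          ENNReal.ofReal (((F n).card : ℝ)⁻¹ * (ν[S (F n) | invSigma G ν]) y) ∂ν) atTop := by
  refine (lintegral_liminf_le' fun n => ?_).trans_eq ?_
  · exact ((hS.integrable (F n)).1.aemeasurable.div_const _).ennreal_ofReal.restrict
  · simp_rw [← hS.setLIntegral_ofReal_condExp _ (inv_nonneg.2 (Nat.cast_nonneg _)) hD,
      div_eq_inv_mul]

variable [Countable G] [MeasurableConstSMul G Y] [SMulInvariantMeasure G Y ν]

lemma image_mul_mul (hS : IsSuperadditiveFamily ν S) (T : Finset G) (t c : G) :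
    ∀ᵐ y ∂ν, S (T.image fun s => t * s * c) y = S T ((t * c) • y) := by
  filter_upwards [hS.invariant (T.image (t * ·)) c,
    ae_forall_smul (G := G) (hS.biinvariant T t), ae_forall_smul (G := G) (hS.invariant T t)]
    with y h1 h2 h3
  rw [Finset.image_image] at h1
  rw [mul_smul, ← h3 c, ← h2 c, ← h1]
  rfl

lemma sum_le_card_mul (hS : IsSuperadditiveFamily ν S) {T : Finset G} {τ γ : G → G}
    (hτ : ∀ g, τ g ∈ T) (hτγ : ∀ g, τ g * γ g = g)
    (hdisj : ∀ g g', τ g = τ g' → g ≠ g' →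
        Disjoint (T.image fun s => τ g * s * γ g) (T.image fun s => τ g' * s * γ g')) :
    ∀ᵐ y ∂ν, ∀ A : Finset G,
      ∑ g ∈ A.filter (fun g => (T.image fun s => τ g * s * γ g) ⊆ A), S T (g • y)
        ≤ T.card * S A y := by
  have hpiece : ∀ᵐ y ∂ν, ∀ g, S (T.image fun s => τ g * s * γ g) y = S T (g • y) :=
    ae_all_iff.2 fun g => by simpa [hτγ g] using hS.image_mul_mul T (τ g) (γ g)
  have hsup : ∀ᵐ y ∂ν, ∀ A B, Disjoint A B → S A y + S B y ≤ S (A ∪ B) y :=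
    ae_all_iff.2 fun A => ae_all_iff.2 fun B => by
      by_cases h : Disjoint A B
      · simpa [h] using hS.superadditive A B h
      · simp [h]
  filter_upwards [hpiece, hsup, ae_all_iff.2 hS.nonneg] with y h1 h2 h3 A
  rw [← Finset.sum_fiberwise_of_maps_to (t := T) (g := τ) (fun g _ => hτ g), ← nsmul_eq_mul,
    ← Finset.sum_const]
  refine Finset.sum_le_sum fun t _ => ?_
  simp_rw [← h1]
  refine sum_le_of_superadditive_s5 (φ := fun A => S A y) (hS.empty y) h3 h2 ?_ ?_
  · intro g hg g' hg' hne
    simp only [Finset.coe_filter, Finset.mem_filter, Set.mem_ofPred_eq] at hg hg'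
    exact hdisj g g' (hg.2.trans hg'.2.symm) hne
  · intro g hg
    simp only [Finset.mem_filter] at hg
    exact hg.1.2

variable [IsProbabilityMeasure ν] {F : ℕ → Finset G}

lemma condExp_min_le_liminf (hS : IsSuperadditiveFamily ν S) (hF : IsFolner F)
    (htemp : IsTempered F) {T : Finset G} (hT : Tiles T) (k : ℕ) :
    ∀ᵐ y ∂ν,
      ENNReal.ofReal ((T.card : ℝ)⁻¹ * (ν[fun y => min (S T y) k | invSigma G ν]) y)
        ≤ liminf (fun n => ENNReal.ofReal (S (F n) y / (F n).card)) atTop := by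
  obtain ⟨τ, γ, hτ, hτγ, hdisj⟩ := hT.exists_decomposition
  have hconv := averageConverges_of_integrable (ν := ν) hF htemp
    ((hS.integrable T).inf (integrable_const (k : ℝ)))
  have hb := hF.tendsto_card_filter_not_subset hτ hτγ
  have hTc : (0 : ℝ) < T.card := by exact_mod_cast hT.1.card_pos
  filter_upwards [hconv, hS.sum_le_card_mul hτ hτγ hdisj] with y h1 h2
  have hlim : Tendsto (fun n => (T.card : ℝ)⁻¹ * (orbitAverage (F n) (S T ⊓ fun _ => (k : ℝ)) y
      - k * ((((F n).filter fun g =>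
        ¬ (T.image fun s => τ g * s * γ g) ⊆ F n).card : ℝ) / ((F n).card : ℝ)))) atTop
      (𝓝 ((T.card : ℝ)⁻¹ * (ν[fun y => min (S T y) k | invSigma G ν]) y)) := by
    have := (h1.sub (hb.const_mul (k : ℝ))).const_mul (T.card : ℝ)⁻¹
    rw [mul_zero, sub_zero] at this
    exact this
  rw [← ((ENNReal.continuous_ofReal.tendsto _).comp hlim).liminf_eq]
  refine liminf_le_liminf (Eventually.of_forall fun n => ENNReal.ofReal_le_ofReal ?_)
  have hFc : (0 : ℝ) < (F n).card := by exact_mod_cast (hF.1 n).card_pos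
  rw [inv_mul_le_iff₀ hTc, orbitAverage, ← mul_div_assoc, ← sub_div, ← mul_div_assoc]
  gcongr
  rw [sub_le_iff_le_add]
  refine le_trans ?_ (add_le_add_left (h2 (F n)) _)
  rw [← Finset.sum_filter_add_sum_filter_not (F n)
    (fun g => (T.image fun s => τ g * s * γ g) ⊆ F n)]
  refine add_le_add (Finset.sum_le_sum fun g _ => inf_le_left) ?_
  refine (Finset.sum_le_card_nsmul _ _ (k : ℝ) fun g _ => inf_le_right).trans ?_
  rw [nsmul_eq_mul, mul_comm]

lemma condExp_le_liminf (hS : IsSuperadditiveFamily ν S) (hF : IsFolner F)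
    (htemp : IsTempered F) {T : Finset G} (hT : Tiles T) :
    ∀ᵐ y ∂ν,
      ENNReal.ofReal ((T.card : ℝ)⁻¹ * (ν[S T | invSigma G ν]) y)
        ≤ liminf (fun n => ENNReal.ofReal (S (F n) y / (F n).card)) atTop := by
  set f : ℕ → Y → ℝ := fun k y => min (S T y) k with hf
  have hfi : ∀ k, Integrable (f k) ν := fun k => (hS.integrable T).inf (integrable_const (k : ℝ))
  have hL1 : Tendsto (fun k => eLpNorm (f k - S T) 1 ν) atTop (𝓝 0) := by
    simp_rw [eLpNorm_one_eq_lintegral_enorm, Pi.sub_apply]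
    have hlim : ∀ᵐ y ∂ν, Tendsto (fun k => ‖f k y - S T y‖ₑ) atTop (𝓝 0) := by
      filter_upwards with y
      refine tendsto_const_nhds.congr' ?_
      filter_upwards [eventually_ge_atTop ⌈S T y⌉₊] with k hk
      have : f k y = S T y := min_eq_left (Nat.ceil_le.1 hk)
      simp [this]
    have := tendsto_lintegral_of_dominated_convergence' (μ := ν) (fun y => ‖S T y‖ₑ)
      (fun k => ((hfi k).sub (hS.integrable T)).1.enorm) (fun k => by
        filter_upwards [hS.nonneg T] with y hy
        rw [Pi.sub_apply, enorm_le_iff_norm_le, Real.norm_eq_abs, Real.norm_eq_abs, abs_le]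
        have h1 : f k y ≤ S T y := min_le_left _ _
        have h2 : 0 ≤ f k y := le_min hy (Nat.cast_nonneg k)
        rw [abs_of_nonneg hy]
        constructor <;> linarith) (hS.integrable T).2.ne hlim
    simpa using this
  have hL1' : Tendsto (fun k => eLpNorm (ν[f k | invSigma G ν] - ν[S T | invSigma G ν]) 1 ν)
      atTop (𝓝 0) := by
    refine tendsto_of_tendsto_of_tendsto_of_le_of_le tendsto_const_nhds hL1
      (fun _ => zero_le) fun k => ?_
    rw [← eLpNorm_congr_ae (condExp_sub (hfi k) (hS.integrable T) (invSigma G ν))]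
    exact eLpNorm_condExp_le_eLpNorm _ le_rfl
  obtain ⟨ns, -, hns⟩ := (tendstoInMeasure_of_tendsto_eLpNorm one_ne_zero
    (fun k => integrable_condExp.1) integrable_condExp.1 hL1').exists_seq_tendsto_ae
  filter_upwards [hns, ae_all_iff.2 fun k => hS.condExp_min_le_liminf hF htemp hT k] with y h1 h2
  exact le_of_tendsto ((ENNReal.continuous_ofReal.tendsto _).comp
    (h1.const_mul (T.card : ℝ)⁻¹)) (Eventually.of_forall fun k => h2 (ns k))

theorem liminf_ae_eq_iSup (hS : IsSuperadditiveFamily ν S) (hF : IsFolner F)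
    (htemp : IsTempered F) (htile : ∀ n, Tiles (F n)) :
    (fun y => ⨆ T ∈ {T : Finset G | Tiles T},
      ENNReal.ofReal ((T.card : ℝ)⁻¹ * (ν[S T | invSigma G ν]) y)) =ᵐ[ν]
    fun y => liminf (fun n => ENNReal.ofReal (S (F n) y / (F n).card)) atTop := by
  set p : Y → ℝ≥0∞ := fun y => liminf (fun n => ENNReal.ofReal (S (F n) y / (F n).card)) atTop
    with hp
  set q : Y → ℝ≥0∞ := fun y => ⨆ T ∈ {T : Finset G | Tiles T},
      ENNReal.ofReal ((T.card : ℝ)⁻¹ * (ν[S T | invSigma G ν]) y) with hq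
  have hqp : ∀ᵐ y ∂ν, q y ≤ p y := by
    have : ∀ᵐ y ∂ν, ∀ T, Tiles T →
        ENNReal.ofReal ((T.card : ℝ)⁻¹ * (ν[S T | invSigma G ν]) y) ≤ p y :=
      ae_all_iff.2 fun T => by
        by_cases hT : Tiles T
        · simpa [hT] using hS.condExp_le_liminf hF htemp hT
        · simp [hT]
    filter_upwards [this] with y hy
    exact iSup₂_le hy
  have hpm : AEMeasurable p ν := by
    have hm : ∀ n, AEMeasurable (fun y => ENNReal.ofReal (S (F n) y / (F n).card)) ν := fun n =>
      ((hS.integrable (F n)).1.aemeasurable.div_const _).ennreal_ofReal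
    refine ⟨_, Measurable.liminf fun n => (hm n).measurable_mk, ?_⟩
    filter_upwards [ae_all_iff.2 fun n => (hm n).ae_eq_mk] with y hy
    exact congrArg (fun u => liminf u atTop) (funext hy)
  have hint : ∀ D, MeasurableSet[invSigma G ν] D → ∫⁻ y in D, p y ∂ν ≤ ∫⁻ y in D, q y ∂ν := by
    intro D hD
    refine (hS.setLIntegral_liminf_le hD).trans ?_
    refine (liminf_le_liminf (Eventually.of_forall fun n => ?_)).trans
      (liminf_const (f := atTop (α := ℕ)) _).le
    exact lintegral_mono fun y => le_iSup₂_of_le (F n) (htile n) le_rfl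
  have hk : ∀ k : ℕ, ∀ᵐ y ∂ν, q y ≤ k → q y = p y := by
    intro k
    set D := {y | q y ≤ k} with hDdef
    have hD : MeasurableSet[invSigma G ν] D := by
      have := measurable_iSup_condExp (ν := ν) S (measurableSet_Iic (a := (k : ℝ≥0∞)))
      exact this
    have hD' := invSigma_le G ν _ hD
    have hDq : ∀ y ∈ D, q y ≤ k := fun y hy => hy
    refine (ae_restrict_iff' (p := fun y => q y = p y) hD').1 ?_
    refine ae_eq_of_ae_le_of_lintegral_le (ae_restrict_of_ae hqp) ?_ hpm.restrict (hint D hD)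
    refine ne_top_of_le_ne_top (b := (k : ℝ≥0∞) * ν D) ?_ ?_
    · exact ENNReal.mul_ne_top (ENNReal.natCast_ne_top k) (measure_ne_top ν D)
    · calc ∫⁻ y in D, q y ∂ν ≤ ∫⁻ _ in D, (k : ℝ≥0∞) ∂ν := setLIntegral_mono measurable_const hDq
        _ = k * ν D := setLIntegral_const D _
  filter_upwards [hqp, ae_all_iff.2 hk] with y h1 h2
  by_cases hy : q y = ⊤
  · exact le_antisymm h1 (hy ▸ le_top)
  · obtain ⟨k, hk⟩ := ENNReal.exists_nat_gt hy
    exact h2 k hk.le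

theorem lintegral_iSup_condExp (hS : IsSuperadditiveFamily ν S) (hF : IsFolner F)
    (htemp : IsTempered F) (htile : ∀ n, Tiles (F n)) :
    ∫⁻ y, ⨆ T ∈ {T : Finset G | Tiles T},
      ENNReal.ofReal ((T.card : ℝ)⁻¹ * (ν[S T | invSigma G ν]) y) ∂ν
    = ⨆ T ∈ {T : Finset G | Tiles T}, ENNReal.ofReal ((T.card : ℝ)⁻¹ * ∫ y, S T y ∂ν) := by
  have hT : ∀ T : Finset G,
      ∫⁻ y, ENNReal.ofReal ((T.card : ℝ)⁻¹ * (ν[S T | invSigma G ν]) y) ∂ν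
        = ENNReal.ofReal ((T.card : ℝ)⁻¹ * ∫ y, S T y ∂ν) := by
    intro T
    rw [← ofReal_integral_eq_lintegral_ofReal (integrable_condExp.const_mul _), integral_const_mul,
      integral_condExp (invSigma_le G ν)]
    filter_upwards [condExp_nonneg (m := invSigma G ν) (hS.nonneg T)] with y hy
    exact mul_nonneg (by positivity) hy
  refine le_antisymm ?_ (iSup₂_le fun T hTt => ?_)
  · rw [lintegral_congr_ae (hS.liminf_ae_eq_iSup hF htemp htile)]
    have := hS.setLIntegral_liminf_le (F := F) (D := Set.univ) MeasurableSet.univ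
    simp only [Measure.restrict_univ, hT] at this
    refine this.trans ((liminf_le_liminf (Eventually.of_forall fun n => ?_)).trans
      (liminf_const (f := atTop (α := ℕ)) _).le)
    exact le_iSup₂_of_le (F n) (htile n) le_rfl
  · rw [← hT]
    exact lintegral_mono fun y => le_iSup₂_of_le T hTt le_rfl

end IsSuperadditiveFamily

end Superadditive

section ExtendedReals

lemma antitone_coe_sub_coe_ennreal (a : ℝ) :
    Antitone fun x : ℝ≥0∞ => (a : EReal) - (x : EReal) := fun _ _ h =>
  EReal.sub_le_sub le_rfl (EReal.coe_ennreal_le_coe_ennreal_iff.2 h)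

lemma continuous_coe_sub_coe_ennreal (a : ℝ) :
    Continuous fun x : ℝ≥0∞ => (a : EReal) - (x : EReal) := by
  simp_rw [sub_eq_add_neg]
  refine continuous_iff_continuousAt.2 fun x => ?_
  exact (EReal.continuousAt_add (p := ((a : EReal), -(x : EReal))) (Or.inl (EReal.coe_ne_top a))
    (Or.inl (EReal.coe_ne_bot a))).comp₂ continuousAt_const
    (continuous_neg.comp continuous_coe_ennreal_ereal).continuousAt

lemma coe_sub_coe_biSup {ι : Type*} (a : ℝ) (u : ι → ℝ≥0∞) {s : Set ι} (hs : s.Nonempty) :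
    (a : EReal) - ((⨆ i ∈ s, u i : ℝ≥0∞) : EReal) = ⨅ i ∈ s, ((a : EReal) - (u i : EReal)) := by
  have := hs.to_subtype
  rw [iSup_subtype', iInf_subtype']
  exact Antitone.map_ciSup_of_continuousAt (continuous_coe_sub_coe_ennreal a).continuousAt
    (antitone_coe_sub_coe_ennreal a)

lemma coe_sub_coe_liminf (a : ℝ) (u : ℕ → ℝ≥0∞) :
    (a : EReal) - ((liminf u atTop : ℝ≥0∞) : EReal)
      = limsup (fun n => (a : EReal) - (u n : EReal)) atTop :=
  (antitone_coe_sub_coe_ennreal a).map_liminf_of_continuousAt u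
    (continuous_coe_sub_coe_ennreal a).continuousAt

lemma limsup_coe_add_le {r v : ℕ → ℝ} (hr : Tendsto r atTop (𝓝 0)) :
    limsup (fun n => ((r n + v n : ℝ) : EReal)) atTop
      ≤ limsup (fun n => ((v n : ℝ) : EReal)) atTop := by
  have hr' : limsup (fun n => ((r n : ℝ) : EReal)) atTop = 0 :=
    (EReal.tendsto_coe.2 hr).limsup_eq
  simp_rw [EReal.coe_add]
  refine (EReal.limsup_add_le (Or.inl ?_) (Or.inl ?_)).trans_eq ?_
  · simp [hr']
  · simp [hr']
  · rw [hr', zero_add]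

lemma limsup_coe_add {r v : ℕ → ℝ} (hr : Tendsto r atTop (𝓝 0)) :
    limsup (fun n => ((r n + v n : ℝ) : EReal)) atTop
      = limsup (fun n => ((v n : ℝ) : EReal)) atTop := by
  refine le_antisymm (limsup_coe_add_le hr) ?_
  have := limsup_coe_add_le (v := fun n => r n + v n) (neg_zero (G := ℝ) ▸ hr.neg)
  simpa using this

lemma coe_sub_coe_ofReal (a : ℝ) {x : ℝ} (hx : 0 ≤ x) :
    (a : EReal) - ((ENNReal.ofReal x : ℝ≥0∞) : EReal) = ((a - x : ℝ) : EReal) := by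
  rw [EReal.coe_ennreal_ofReal, max_eq_left hx, EReal.coe_sub]

@[simp]
lemma erealPosPart_coe (x : ℝ) : erealPosPart (x : EReal) = ENNReal.ofReal x := by
  simp [erealPosPart]

@[simp]
lemma erealPosPart_top : erealPosPart ⊤ = ⊤ := by
  simp [erealPosPart]

lemma coe_ennreal_sub_eq_coe {x y : ℝ≥0∞} (hx : x ≠ ⊤) (hy : y ≠ ⊤) :
    (x : EReal) - (y : EReal) = ((x.toReal - y.toReal : ℝ) : EReal) := by
  lift x to NNReal using hx
  lift y to NNReal using hy
  rfl

lemma erealIntegral_congr_ae {Y : Type*} [MeasurableSpace Y] {ν : Measure Y} {f g : Y → EReal}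
    (h : f =ᵐ[ν] g) : erealIntegral ν f = erealIntegral ν g := by
  have h1 := lintegral_congr_ae (h.fun_comp erealPosPart)
  have h2 := lintegral_congr_ae (h.fun_comp fun x => erealPosPart (-x))
  simp only [Function.comp_apply] at h1 h2
  rw [erealIntegral, erealIntegral, h1, h2]

lemma erealIntegral_coe {Y : Type*} [MeasurableSpace Y] {ν : Measure Y} {f : Y → ℝ}
    (hf : Integrable f ν) :
    erealIntegral ν (fun y => (f y : EReal)) = ((∫ y, f y ∂ν : ℝ) : EReal) := by
  simp only [erealIntegral, ← EReal.coe_neg, erealPosPart_coe]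
  rw [integral_eq_lintegral_pos_part_sub_lintegral_neg_part hf, coe_ennreal_sub_eq_coe]
  · exact hf.lintegral_lt_top.ne
  · exact hf.neg.lintegral_lt_top.ne

lemma erealIntegral_coe_sub_coe_ennreal {Y : Type*} [MeasurableSpace Y] {ν : Measure Y}
    {a : Y → ℝ} (ha : Integrable a ν) {q : Y → ℝ≥0∞} (hq : AEMeasurable q ν) :
    erealIntegral ν (fun y => (a y : EReal) - (q y : EReal))
      = ((∫ y, a y ∂ν : ℝ) : EReal) - ((∫⁻ y, q y ∂ν : ℝ≥0∞) : EReal) := by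
  by_cases hqt : ∫⁻ y, q y ∂ν = ⊤
  · have hle : ∀ y, q y
        ≤ erealPosPart (-((a y : EReal) - (q y : EReal))) + ENNReal.ofReal (a y) := by
      intro y
      by_cases hy : q y = ⊤
      · simp [hy]
      · have h := coe_sub_coe_ofReal (a y) (ENNReal.toReal_nonneg (a := q y))
        rw [ENNReal.ofReal_toReal hy] at h
        rw [h, ← EReal.coe_neg, erealPosPart_coe]
        refine le_trans ?_ ENNReal.ofReal_add_le
        rw [neg_sub, sub_add_cancel, ENNReal.ofReal_toReal hy]
    have hneg : ∫⁻ y, erealPosPart (-((a y : EReal) - (q y : EReal))) ∂ν = ⊤ := by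
      have h := lintegral_mono (μ := ν) hle
      rw [lintegral_add_right' _ ha.1.aemeasurable.ennreal_ofReal, hqt, top_le_iff,
        ENNReal.add_eq_top] at h
      exact h.resolve_right ha.lintegral_lt_top.ne
    rw [erealIntegral, hneg, hqt]
    simp [sub_eq_add_neg]
  · have hqi := integrable_toReal_of_lintegral_ne_top hq hqt
    have hae : (fun y => (a y : EReal) - (q y : EReal))
        =ᵐ[ν] fun y => ((a y - (q y).toReal : ℝ) : EReal) := by
      filter_upwards [ae_lt_top' hq hqt] with y hy
      rw [← coe_sub_coe_ofReal _ ENNReal.toReal_nonneg, ENNReal.ofReal_toReal hy.ne]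
    have hsub := erealIntegral_coe (ha.sub hqi)
    simp only [Pi.sub_apply] at hsub
    rw [erealIntegral_congr_ae hae, hsub, integral_sub ha hqi,
      ← coe_sub_coe_ofReal _ (integral_nonneg fun y => ENNReal.toReal_nonneg),
      integral_toReal hq (ae_lt_top' hq hqt), ENNReal.ofReal_toReal hqt]

end ExtendedReals

section Excess

variable {G Y : Type*} [Group G] [DecidableEq G] [MulAction G Y]

/-- The defect of additivity of the family `d` on the finite set `A`. -/
def excess (d : Finset G → Y → ℝ) (A : Finset G) (y : Y) : ℝ :=
  if A = ∅ then 0 else (∑ g ∈ A, d {1} (g • y)) - d A y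

lemma excess_of_nonempty (d : Finset G → Y → ℝ) {A : Finset G} (hA : A.Nonempty) (y : Y) :
    excess d A y = (∑ g ∈ A, d {1} (g • y)) - d A y :=
  if_neg hA.ne_empty

variable [MeasurableSpace Y] {ν : Measure Y} {d : Finset G → Y → ℝ}

lemma ae_excess_add_le (hsub : ∀ E F : Finset G, E.Nonempty → F.Nonempty → Disjoint E F →
      ∀ᵐ y ∂ν, d (E ∪ F) y ≤ d E y + d F y) {A B : Finset G} (hAB : Disjoint A B) :
    ∀ᵐ y ∂ν, excess d A y + excess d B y ≤ excess d (A ∪ B) y := by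
  rcases A.eq_empty_or_nonempty with rfl | hA
  · simp [excess]
  rcases B.eq_empty_or_nonempty with rfl | hB
  · simp [excess]
  filter_upwards [hsub A B hA hB hAB] with y hy
  rw [excess_of_nonempty d hA, excess_of_nonempty d hB,
    excess_of_nonempty d (hA.mono Finset.subset_union_left), Finset.sum_union hAB]
  linarith

lemma ae_excess_nonneg
    (hinv : ∀ F : Finset G, F.Nonempty → ∀ g : G,
      ∀ᵐ y ∂ν, d (F.image (· * g)) y = d F (g • y))
    (hsub : ∀ E F : Finset G, E.Nonempty → F.Nonempty → Disjoint E F →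
      ∀ᵐ y ∂ν, d (E ∪ F) y ≤ d E y + d F y) (A : Finset G) :
    ∀ᵐ y ∂ν, 0 ≤ excess d A y := by
  induction A using Finset.induction_on with
  | empty => simp [excess]
  | insert a A ha ih =>
    rw [Finset.insert_eq]
    filter_upwards [ih, ae_excess_add_le hsub (Finset.disjoint_singleton_left.2 ha),
      hinv {1} (Finset.singleton_nonempty 1) a] with y h1 h2 h3
    have h4 : excess d {a} y = 0 := by
      rw [excess_of_nonempty d (Finset.singleton_nonempty a), Finset.sum_singleton, ← h3]
      simp
    linarith

variable [MeasurableConstSMul G Y] [SMulInvariantMeasure G Y ν]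

lemma isSuperadditiveFamily_excess [Countable G]
    (hint : ∀ F : Finset G, F.Nonempty → Integrable (d F) ν)
    (hinv : ∀ F : Finset G, F.Nonempty → ∀ g : G,
      ∀ᵐ y ∂ν, d (F.image (· * g)) y = d F (g • y))
    (hbi : ∀ F : Finset G, F.Nonempty → ∀ g : G,
      ∀ᵐ y ∂ν, d (F.image (g * ·)) y = d (F.image (· * g)) y)
    (hsub : ∀ E F : Finset G, E.Nonempty → F.Nonempty → Disjoint E F →
      ∀ᵐ y ∂ν, d (E ∪ F) y ≤ d E y + d F y) :
    IsSuperadditiveFamily ν (excess d) where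
  empty y := if_pos rfl
  integrable A := by
    rcases A.eq_empty_or_nonempty with rfl | hA
    · rw [show excess d ∅ = 0 from funext fun _ => if_pos rfl]
      exact integrable_zero _ _ _
    · have : excess d A = fun y => (∑ g ∈ A, d {1} (g • y)) - d A y :=
        funext (excess_of_nonempty d hA)
      rw [this]
      refine (integrable_finsetSum _ fun g _ => ?_).sub (hint A hA)
      exact (measurePreserving_smul g ν).integrable_comp_of_integrable
        (hint {1} (Finset.singleton_nonempty 1))
  nonneg A := ae_excess_nonneg hinv hsub A
  invariant A g := by
    rcases A.eq_empty_or_nonempty with rfl | hA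
    · simp [excess]
    filter_upwards [hinv A hA g] with y hy
    rw [excess_of_nonempty d hA, excess_of_nonempty d (hA.image _), hy,
      Finset.sum_image (mul_left_injective g).injOn]
    simp_rw [mul_smul]
  biinvariant A g := by
    rcases A.eq_empty_or_nonempty with rfl | hA
    · simp [excess]
    have h1 : ∀ᵐ y ∂ν, ∀ h : G, d {h} y = d {1} (h • y) := ae_all_iff.2 fun h => by
      simpa using hinv {1} (Finset.singleton_nonempty 1) h
    have h2 : ∀ᵐ y ∂ν, ∀ h : G, d {g * h} y = d {h * g} y := ae_all_iff.2 fun h => by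
      simpa using hbi {h} (Finset.singleton_nonempty h) g
    filter_upwards [hbi A hA g, h1, h2] with y hy h1 h2
    rw [excess_of_nonempty d (hA.image _), excess_of_nonempty d (hA.image _), hy,
      Finset.sum_image (mul_left_injective g).injOn, Finset.sum_image (mul_right_injective g).injOn]
    simp_rw [← h1, h2]
  superadditive A B hAB := ae_excess_add_le hsub hAB

lemma integral_excess (hint : ∀ F : Finset G, F.Nonempty → Integrable (d F) ν) {A : Finset G}
    (hA : A.Nonempty) :
    (A.card : ℝ)⁻¹ * ∫ y, d A y ∂ν
      = ∫ y, d {1} y ∂ν - (A.card : ℝ)⁻¹ * ∫ y, excess d A y ∂ν := by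
  have hf := hint {1} (Finset.singleton_nonempty 1)
  have hfg : ∀ g : G, Integrable (fun y => d {1} (g • y)) ν := fun g =>
    (measurePreserving_smul g ν).integrable_comp_of_integrable hf
  simp_rw [excess_of_nonempty d hA]
  rw [integral_sub (integrable_finsetSum _ fun g _ => hfg g) (hint A hA),
    integral_finsetSum _ fun g _ => hfg g]
  simp_rw [integral_smul_eq_self (μ := ν) (d {1})]
  have : (A.card : ℝ) ≠ 0 := by exact_mod_cast hA.card_pos.ne'
  rw [Finset.sum_const, nsmul_eq_mul]
  field_simp
  ring

lemma condExp_excess [Countable G] [IsProbabilityMeasure ν]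
    (hint : ∀ F : Finset G, F.Nonempty → Integrable (d F) ν) {A : Finset G}
    (hA : A.Nonempty) :
    ∀ᵐ y ∂ν, (A.card : ℝ)⁻¹ * (ν[d A | invSigma G ν]) y
      = (ν[d {1} | invSigma G ν]) y - (A.card : ℝ)⁻¹ * (ν[excess d A | invSigma G ν]) y := by
  have hf := hint {1} (Finset.singleton_nonempty 1)
  have hfg : ∀ g : G, Integrable (fun y => d {1} (g • y)) ν := fun g =>
    (measurePreserving_smul g ν).integrable_comp_of_integrable hf
  have he : excess d A = (∑ g ∈ A, fun y => d {1} (g • y)) - d A := by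
    ext y
    simp [excess_of_nonempty d hA]
  rw [he]
  filter_upwards [condExp_sub (integrable_finsetSum' A fun g _ => hfg g) (hint A hA)
      (invSigma G ν), condExp_finsetSum (fun g _ => hfg g) (invSigma G ν) (s := A),
    ae_all_iff.2 fun g : G => condExp_invSigma_comp_smul hf g] with y h1 h2 h3
  rw [h1, Pi.sub_apply, h2, Finset.sum_apply, Finset.sum_congr rfl fun g _ => h3 g,
    Finset.sum_const, nsmul_eq_mul]
  have : (A.card : ℝ) ≠ 0 := by exact_mod_cast hA.card_pos.ne'
  field_simp
  ring

end Excess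

/-- Theorem 4.1 of the paper: for a sub-additive `G`-bi-invariant family `𝐃 ⊆ L¹(ν)` and a
tempered tiling Følner sequence, `limsup_n d_{F_n}(y)/|F_n| = inf_{T ∈ 𝒯_G} (1/|T|)E(d_T|𝓘)(y)`
a.e.; this function is `G`-invariant and measurable, and its integral equals
`ν(𝐃) = inf_{T ∈ 𝒯_G} (1/|T|) ∫ d_T dν`. -/
theorem limsup_subadditive_biinvariant
    {G : Type*} [Group G] [Countable G] [Infinite G] [DecidableEq G]
    {Y : Type*} [MeasurableSpace Y] [MulAction G Y]
    (ν : Measure Y) [IsProbabilityMeasure ν]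
    (hact : ∀ g : G, MeasurePreserving (fun y => g • y) ν ν)
    (d : Finset G → Y → ℝ)
    (hint : ∀ F : Finset G, F.Nonempty → Integrable (d F) ν)
    (hinv : ∀ F : Finset G, F.Nonempty → ∀ g : G,
      ∀ᵐ y ∂ν, d (F.image (· * g)) y = d F (g • y))
    (hbi : ∀ F : Finset G, F.Nonempty → ∀ g : G,
      ∀ᵐ y ∂ν, d (F.image (g * ·)) y = d (F.image (· * g)) y)
    (hsub : ∀ E F : Finset G, E.Nonempty → F.Nonempty → Disjoint E F →
      ∀ᵐ y ∂ν, d (E ∪ F) y ≤ d E y + d F y)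
    (F : ℕ → Finset G) (hF : IsFolner F) (htemp : IsTempered F)
    (htile : ∀ n, Tiles (F n)) :
    (∀ᵐ y ∂ν,
        limsup (fun n => ((d (F n) y / ((F n).card : ℝ) : ℝ) : EReal)) atTop
          = ⨅ T ∈ {T : Finset G | Tiles T},
              (((T.card : ℝ)⁻¹ * (ν[d T | invSigma G ν]) y : ℝ) : EReal)) ∧
    Measurable (fun y => ⨅ T ∈ {T : Finset G | Tiles T},
        (((T.card : ℝ)⁻¹ * (ν[d T | invSigma G ν]) y : ℝ) : EReal)) ∧
    (∀ g : G, ∀ᵐ y ∂ν,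
        (⨅ T ∈ {T : Finset G | Tiles T},
            (((T.card : ℝ)⁻¹ * (ν[d T | invSigma G ν]) (g • y) : ℝ) : EReal))
          = ⨅ T ∈ {T : Finset G | Tiles T},
              (((T.card : ℝ)⁻¹ * (ν[d T | invSigma G ν]) y : ℝ) : EReal)) ∧
    erealIntegral ν (fun y => ⨅ T ∈ {T : Finset G | Tiles T},
        (((T.card : ℝ)⁻¹ * (ν[d T | invSigma G ν]) y : ℝ) : EReal))
      = ⨅ T ∈ {T : Finset G | Tiles T},
          (((T.card : ℝ)⁻¹ * ∫ y, d T y ∂ν : ℝ) : EReal) := by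
  have : MeasurableConstSMul G Y := ⟨fun g => (hact g).measurable⟩
  have : SMulInvariantMeasure G Y ν :=
    ⟨fun g s hs => (hact g).measure_preimage hs.nullMeasurableSet⟩
  have hS := isSuperadditiveFamily_excess hint hinv hbi hsub
  have hne : {T : Finset G | Tiles T}.Nonempty := ⟨F 0, htile 0⟩
  have hf := hint {1} (Finset.singleton_nonempty 1)
  set a : Y → ℝ := ν[d {1} | invSigma G ν] with ha
  set q : Y → ℝ≥0∞ := fun y => ⨆ T ∈ {T : Finset G | Tiles T},
    ENNReal.ofReal ((T.card : ℝ)⁻¹ * (ν[excess d T | invSigma G ν]) y) with hq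
  have hψ : ∀ᵐ y ∂ν, (⨅ T ∈ {T : Finset G | Tiles T},
      (((T.card : ℝ)⁻¹ * (ν[d T | invSigma G ν]) y : ℝ) : EReal))
        = (a y : EReal) - (q y : EReal) := by
    have h1 : ∀ᵐ y ∂ν, ∀ T : Finset G, T.Nonempty → (T.card : ℝ)⁻¹ * (ν[d T | invSigma G ν]) y
        = a y - (T.card : ℝ)⁻¹ * (ν[excess d T | invSigma G ν]) y := ae_all_iff.2 fun T => by
      by_cases hT : T.Nonempty
      · simpa [hT] using condExp_excess hint hT
      · simp [hT]
    filter_upwards [h1, ae_all_iff.2 fun T =>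
      condExp_nonneg (m := invSigma G ν) (f := excess d T) (hS.nonneg T)] with y h1 h2
    rw [hq, coe_sub_coe_biSup _ _ hne]
    refine iInf_congr fun T => iInf_congr fun hT => ?_
    rw [h1 T hT.1, coe_sub_coe_ofReal _ (mul_nonneg (by positivity) (h2 T))]
  refine ⟨?_, ?_, fun g => ?_, ?_⟩
  · filter_upwards [hψ, hS.liminf_ae_eq_iSup hF htemp htile,
      averageConverges_of_integrable hF htemp hf, ae_all_iff.2 hS.nonneg] with y h1 h2 h3 h4
    have h3' : Tendsto (fun n => orbitAverage (F n) (d {1}) y - a y) atTop (𝓝 0) := by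
      rw [← sub_self (a y)]
      exact h3.sub_const (a y)
    have h5 : ∀ n, d (F n) y / ((F n).card : ℝ) = (orbitAverage (F n) (d {1}) y - a y)
        + (a y - excess d (F n) y / ((F n).card : ℝ)) := by
      intro n
      rw [excess_of_nonempty d (hF.1 n), orbitAverage]
      ring
    simp_rw [h5]
    have h2' : q y = liminf (fun n => ENNReal.ofReal (excess d (F n) y / (F n).card)) atTop := h2
    rw [limsup_coe_add h3', h1, h2', coe_sub_coe_liminf]
    simp_rw [coe_sub_coe_ofReal _ (div_nonneg (h4 _) (Nat.cast_nonneg _))]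
  · exact Measurable.biInf _ (Set.to_countable _) fun T _ =>
      ((stronglyMeasurable_condExp.mono (invSigma_le G ν)).measurable.const_mul _).coe_real_ereal
  · filter_upwards [ae_all_iff.2 fun T => condExp_invSigma_smul_ae_eq (ν := ν) (d T) g] with y hy
    simp_rw [hy]
  · rw [erealIntegral_congr_ae hψ, erealIntegral_coe_sub_coe_ennreal integrable_condExp
        ((measurable_iSup_condExp _).mono (invSigma_le G ν) le_rfl).aemeasurable,
      hS.lintegral_iSup_condExp hF htemp htile, integral_condExp (invSigma_le G ν),
      coe_sub_coe_biSup _ _ hne]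
    refine iInf_congr fun T => iInf_congr fun hT => ?_
    rw [coe_sub_coe_ofReal, integral_excess hint hT.1]
    exact mul_nonneg (by positivity) (integral_nonneg_of_ae (hS.nonneg T))
end
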